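/- arXiv:2306.07482 — 4 statements merged into one kernel-verified Lean document; each statement's English description precedes it below -/
import Mathlib

section
/- For every integer k ≥ 1, every z ∈ ℂ∖{0} and all vectors α, γ of nonzero complex numbers, det φ^b(z;α,γ) = γ̂ − (−1)^k α̂ z^{−1}, where α̂ = α_1⋯α_k and γ̂ = γ_1⋯γ_k; and for every vector β of nonzero complex numbers with β := β_1⋯β_k and every z ∉ {0, β}, det φ^g(z;β) = (1 − βz^{−1})^{−1}. -/
open scoped BigOperators

/-- The matrix `φ^b(z;α,γ)`: `diag(γ) + Σ_{i=1}^{k−1} α_i E_{i+1,i} + α_k z⁻¹ E_{1,k}`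
(indices here are 0-based). -/
noncomputable def phiB (k : ℕ) (z : ℂ) (α γ : Fin k → ℂ) : Matrix (Fin k) (Fin k) ℂ :=
  Matrix.of fun (i j : Fin k) =>
    (if i = j then γ i else 0) + (if (i : ℕ) = (j : ℕ) + 1 then α j else 0) +
      (if (i : ℕ) = 0 ∧ (j : ℕ) = k - 1 then α j * z⁻¹ else 0)

/-- Value of a `Fin k`-indexed vector at a natural number (1 outside range). -/
noncomputable def bval {k : ℕ} (β : Fin k → ℂ) (m : ℕ) : ℂ :=
  if h : m < k then β ⟨m, h⟩ else 1

/-- The matrix `φ^g(z;β) = (1 − β z⁻¹)⁻¹ G(z;β)` with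
`G_{ij} = β_j⋯β_{i−1}` for `i ≥ j` and `G_{ij} = z⁻¹ (β_j⋯β_k)(β_1⋯β_{i−1})` for `i < j`
(0-based indices). -/
noncomputable def phiG (k : ℕ) (z : ℂ) (β : Fin k → ℂ) : Matrix (Fin k) (Fin k) ℂ :=
  (1 - (∏ i, β i) * z⁻¹)⁻¹ •
    Matrix.of fun (i j : Fin k) =>
      if (j : ℕ) ≤ (i : ℕ) then ∏ m ∈ Finset.Ico (j : ℕ) (i : ℕ), bval β m
      else z⁻¹ * (∏ m ∈ Finset.Ico (j : ℕ) k, bval β m) * ∏ m ∈ Finset.Ico 0 (i : ℕ), bval β m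

/-- Subdiagonal-plus-diagonal part of `phiB`, i.e. `phiB` without its corner entry. -/
noncomputable def lowerBidiagonal (n : ℕ) (α γ : Fin (n + 1) → ℂ) :
    Matrix (Fin (n + 1)) (Fin (n + 1)) ℂ :=
  Matrix.of fun i j => (if i = j then γ i else 0) + (if (i : ℕ) = (j : ℕ) + 1 then α j else 0)

lemma det_lowerBidiagonal (n : ℕ) (α γ : Fin (n + 1) → ℂ) :
    (lowerBidiagonal n α γ).det = ∏ i, γ i := by
  rw [Matrix.det_of_isLowerTriangular]
  · simp [lowerBidiagonal]
  · intro i j hij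
    have h : (i : ℕ) < j := hij
    have h₁ : i ≠ j := fun e => by simp [e] at h
    have h₂ : (i : ℕ) ≠ j + 1 := by omega
    simp [lowerBidiagonal, h₁, h₂]

lemma det_lowerBidiagonal_submatrix (n : ℕ) (α γ : Fin (n + 1) → ℂ) :
    ((lowerBidiagonal n α γ).submatrix Fin.succ Fin.castSucc).det = ∏ i : Fin n, α i.castSucc := by
  rw [Matrix.det_of_isUpperTriangular]
  · refine Finset.prod_congr rfl fun i _ => ?_
    have h : i.succ ≠ i.castSucc := by simp [Fin.ext_iff]
    simp [lowerBidiagonal, h]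
  · intro i j hij
    have h : (j : ℕ) < i := hij
    have h₁ : i.succ ≠ j.castSucc := by
      simp only [ne_eq, Fin.ext_iff, Fin.val_succ, Fin.val_castSucc]; omega
    have h₂ : (i : ℕ) ≠ j := by omega
    simp [lowerBidiagonal, h₁, h₂]

lemma phiB_eq_updateRow (n : ℕ) (z : ℂ) (α γ : Fin (n + 1) → ℂ) :
    phiB (n + 1) z α γ = (lowerBidiagonal n α γ).updateRow 0
      (lowerBidiagonal n α γ 0 + (α (Fin.last n) * z⁻¹) • Pi.single (Fin.last n) 1) := by
  ext i j
  by_cases hi : i = 0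
  · subst hi
    by_cases hj : j = Fin.last n
    · subst hj
      simp [phiB, lowerBidiagonal]
    · have h : (j : ℕ) ≠ n := fun e => hj (Fin.ext e)
      simp [phiB, lowerBidiagonal, hj, h]
  · have h : (i : ℕ) ≠ 0 := fun e => hi (Fin.ext e)
    simp [phiB, lowerBidiagonal, hi]

lemma det_phiB_succ (n : ℕ) (z : ℂ) (α γ : Fin (n + 1) → ℂ) :
    (phiB (n + 1) z α γ).det = (∏ i, γ i) - (-1 : ℂ) ^ (n + 1) * (∏ i, α i) * z⁻¹ := by
  rw [phiB_eq_updateRow, Matrix.det_updateRow_add, Matrix.det_updateRow_smul,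
    Matrix.updateRow_eq_self, det_lowerBidiagonal, ← Matrix.adjugate_apply,
    Matrix.adjugate_fin_succ_eq_det_submatrix, Fin.prod_univ_castSucc α]
  have h := det_lowerBidiagonal_submatrix n α γ
  simp only [Fin.succAbove_zero, Fin.succAbove_last, h, Fin.val_zero, Fin.val_last]
  ring

lemma prod_Ico_bval {k : ℕ} (β : Fin k → ℂ) :
    ∏ m ∈ Finset.Ico 0 k, bval β m = ∏ i, β i := by
  rw [← Finset.range_eq_Ico, Finset.prod_range]
  simp [bval]

/-- The unnormalised matrix `G(z;β)` entering `phiG`. -/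
noncomputable def geomMatrix (k : ℕ) (z : ℂ) (β : Fin k → ℂ) : Matrix (Fin k) (Fin k) ℂ :=
  Matrix.of fun (i j : Fin k) =>
    if (j : ℕ) ≤ (i : ℕ) then ∏ m ∈ Finset.Ico (j : ℕ) (i : ℕ), bval β m
    else z⁻¹ * (∏ m ∈ Finset.Ico (j : ℕ) k, bval β m) * ∏ m ∈ Finset.Ico 0 (i : ℕ), bval β m

lemma geomMatrix_succ (n : ℕ) (z : ℂ) (β : Fin (n + 1) → ℂ) (i : Fin n) (j : Fin (n + 1)) :
    geomMatrix (n + 1) z β i.succ j =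
      (if i.succ = j then 1 - (∏ i, β i) * z⁻¹ else 0) +
        bval β i * geomMatrix (n + 1) z β i.castSucc j := by
  simp only [geomMatrix, Matrix.of_apply, Fin.ext_iff, Fin.val_succ, Fin.val_castSucc]
  rcases lt_trichotomy (j : ℕ) (i + 1) with h | h | h
  · have h₁ : (j : ℕ) ≤ i := by omega
    rw [if_pos h.le, if_neg h.ne', if_pos h₁, Finset.prod_Ico_succ_top h₁]
    ring
  · have h₁ : ¬ (j : ℕ) ≤ i := by omega
    rw [if_pos h.le, if_pos h.symm, if_neg h₁, h, Finset.Ico_self, Finset.prod_empty,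
      ← prod_Ico_bval β, ← Finset.prod_Ico_consecutive _ (Nat.zero_le (i + 1))
        (show (i : ℕ) + 1 ≤ n + 1 by omega),
      Finset.prod_Ico_succ_top (Nat.zero_le _)]
    ring
  · have h₁ : ¬ (j : ℕ) ≤ i := by omega
    rw [if_neg h.not_ge, if_neg h.ne, if_neg h₁, Finset.prod_Ico_succ_top (Nat.zero_le _)]
    ring

lemma det_geomMatrix_succ (n : ℕ) (z : ℂ) (β : Fin (n + 1) → ℂ) :
    (geomMatrix (n + 1) z β).det = (1 - (∏ i, β i) * z⁻¹) ^ n := by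
  rw [Matrix.det_eq_of_forall_row_eq_smul_add_pred
    (B := (Matrix.diagonal fun _ => 1 - (∏ i, β i) * z⁻¹).updateRow 0
      (geomMatrix (n + 1) z β 0)) (fun i => bval β i)]
  · rw [Matrix.det_of_isUpperTriangular]
    · simp [Fin.prod_univ_succ, geomMatrix]
    · intro i j hij
      have h : j < i := hij
      have h₀ : i ≠ 0 := ((Fin.zero_le j).trans_lt h).ne'
      simp [Matrix.updateRow_ne h₀, Matrix.diagonal_apply_ne _ h.ne']
  · simp
  · intro i j
    rw [geomMatrix_succ, Matrix.updateRow_ne (Fin.succ_ne_zero i), Matrix.diagonal_apply]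

/-- `det φ^b(z;α,γ) = γ̂ − (−1)^k α̂ z⁻¹` for `z ≠ 0`, and
`det φ^g(z;β) = (1 − β z⁻¹)⁻¹` for `z ∉ {0, β}`. -/
theorem statement0 (k : ℕ) (hk : 1 ≤ k) :
    (∀ z : ℂ, z ≠ 0 → ∀ α γ : Fin k → ℂ, (∀ i, α i ≠ 0) → (∀ i, γ i ≠ 0) →
      (phiB k z α γ).det = (∏ i, γ i) - (-1 : ℂ) ^ k * (∏ i, α i) * z⁻¹) ∧
    (∀ β : Fin k → ℂ, (∀ i, β i ≠ 0) → ∀ z : ℂ, z ≠ 0 → z ≠ ∏ i, β i →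
      (phiG k z β).det = (1 - (∏ i, β i) * z⁻¹)⁻¹) := by
  obtain ⟨n, rfl⟩ := Nat.exists_eq_add_of_le' hk
  refine ⟨fun z _ α γ _ _ => det_phiB_succ n z α γ, fun β _ z hz hzβ => ?_⟩
  have h : 1 - (∏ i, β i) * z⁻¹ ≠ 0 := by
    rw [← div_eq_mul_inv, sub_ne_zero]
    exact fun e => hzβ ((div_eq_one_iff_eq hz).mp e.symm).symm
  change ((1 - (∏ i, β i) * z⁻¹)⁻¹ • geomMatrix (n + 1) z β).det = _
  rw [Matrix.det_smul, det_geomMatrix_succ, Fintype.card_fin, pow_succ', mul_assoc, ← mul_pow,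
    inv_mul_cancel₀ h, one_pow, mul_one]
end

section
/- Let k ≥ 1 and for j = 1,…,k let α⃗_j, γ⃗_j be vectors of nonzero complex numbers. Then each entry of the matrix-valued function z ↦ z·φ^b(z;α⃗_1,γ⃗_1)φ^b(z;α⃗_2,γ⃗_2)⋯φ^b(z;α⃗_k,γ⃗_k) (a priori defined only for z ≠ 0) agrees with a polynomial in z, and the value C' of this polynomial matrix at z = 0 is an upper triangular invertible matrix. -/
open scoped BigOperators

theorem phiB_mul_apply_zero {n : ℕ} (z : ℂ) (α γ : Fin (n + 1) → ℂ)
    (M : Matrix (Fin (n + 1)) (Fin (n + 1)) ℂ) (j : Fin (n + 1)) :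
    (phiB (n + 1) z α γ * M) 0 j =
      γ 0 * M 0 j + z⁻¹ * (α (Fin.last n) * M (Fin.last n) j) := by
  have h (l : Fin (n + 1)) : ((l : ℕ) = n) = (l = Fin.last n) := by
    simp [Fin.ext_iff]
  simp only [Matrix.mul_apply, phiB, Matrix.of_apply, add_mul, Finset.sum_add_distrib]
  simp [h]
  ring

theorem phiB_mul_apply_succ {n : ℕ} (z : ℂ) (α γ : Fin (n + 1) → ℂ)
    (M : Matrix (Fin (n + 1)) (Fin (n + 1)) ℂ) (i : Fin n) (j : Fin (n + 1)) :
    (phiB (n + 1) z α γ * M) i.succ j =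
      γ i.succ * M i.succ j + α i.castSucc * M i.castSucc j := by
  have h (l : Fin (n + 1)) : ((i : ℕ) = l) = (i.castSucc = l) := by
    simp [Fin.ext_iff]
  simp only [Matrix.mul_apply, phiB, Matrix.of_apply, add_mul, Finset.sum_add_distrib]
  simp [h]

/-- A product of at most `n + 1` matrices `phiB` is affine in `z⁻¹`, with banded coefficients
whose extreme diagonals do not vanish. -/
theorem exists_prod_phiB_eq {n : ℕ} (L : List ((Fin (n + 1) → ℂ) × (Fin (n + 1) → ℂ)))
    (hL : L.length ≤ n + 1) (hα : ∀ p ∈ L, ∀ i, p.1 i ≠ 0) :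
    ∃ C D : Fin (n + 1) → Fin (n + 1) → ℂ,
      (∀ z : ℂ, z ≠ 0 → ∀ i j,
        (L.map fun p => phiB (n + 1) z p.1 p.2).prod i j = C i j + z⁻¹ * D i j) ∧
      (∀ i j : Fin (n + 1), (j : ℕ) + L.length < i → C i j = 0) ∧
      (∀ i j : Fin (n + 1), (i : ℕ) = j + L.length → C i j ≠ 0) ∧
      (∀ i j : Fin (n + 1), (j : ℕ) + L.length < i + (n + 1) → D i j = 0) ∧
      (∀ i j : Fin (n + 1), (i : ℕ) + (n + 1) = j + L.length → D i j ≠ 0) := by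
  induction L with
  | nil =>
    refine ⟨fun i j => (1 : Matrix _ _ ℂ) i j, fun _ _ => 0, by simp, ?_, ?_, by simp, ?_⟩
    · intro i j h
      have : i ≠ j := by rintro rfl; simp at h
      simp [this]
    · intro i j h
      obtain rfl : i = j := Fin.ext (by simpa using h)
      simp
    · intro i j h
      simp only [List.length_nil] at h
      omega
  | cons p L ih =>
    simp only [List.length_cons] at hL
    obtain ⟨C, D, h, hC, hC', hD, hD'⟩ :=
      ih (by omega) fun q hq => hα q (List.mem_cons_of_mem _ hq)
    have hp := hα p List.mem_cons_self
    refine ⟨fun i j => Fin.cases (p.2 0 * C 0 j)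
        (fun i' => p.2 i'.succ * C i'.succ j + p.1 i'.castSucc * C i'.castSucc j) i,
      fun i j => Fin.cases (p.2 0 * D 0 j + p.1 (Fin.last n) * C (Fin.last n) j)
        (fun i' => p.2 i'.succ * D i'.succ j + p.1 i'.castSucc * D i'.castSucc j) i,
      ?_, ?_, ?_, ?_, ?_⟩
    · intro z hz i j
      rw [List.map_cons, List.prod_cons]
      refine Fin.cases ?_ (fun i' => ?_) i
      · rw [phiB_mul_apply_zero, h z hz, h z hz, hD (Fin.last n) j (by simp; omega)]
        simp only [Fin.cases_zero]
        ring
      · rw [phiB_mul_apply_succ, h z hz, h z hz]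
        simp only [Fin.cases_succ]
        ring
    all_goals
      intro i j
      refine Fin.cases ?_ (fun i' => ?_) i
      all_goals
        intro hij
        simp only [List.length_cons, Fin.val_zero, Fin.val_succ] at hij
        simp only [Fin.cases_zero, Fin.cases_succ]
    · omega
    · rw [hC _ _ (by simp; omega), hC _ _ (by simp; omega)]
      simp
    · omega
    · rw [hC i'.succ _ (by simp; omega), mul_zero, zero_add]
      exact mul_ne_zero (hp _) (hC' _ _ (by simp; omega))
    · rw [hD _ _ (by simp; omega), hC _ _ (by simp; omega)]
      simp
    · rw [hD _ _ (by simp; omega), hD _ _ (by simp; omega)]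
      simp
    · rw [hD _ _ (by simp; omega), mul_zero, zero_add]
      exact mul_ne_zero (hp _) (hC' _ _ (by simp; omega))
    · rw [hD i'.succ _ (by simp; omega), mul_zero, zero_add]
      exact mul_ne_zero (hp _) (hD' _ _ (by simp; omega))

/-- Each entry of `z ↦ z·φ^b(z;α⃗_1,γ⃗_1)⋯φ^b(z;α⃗_k,γ⃗_k)` agrees with a polynomial in `z`
(for `z ≠ 0`), and the value of this polynomial matrix at `z = 0` is upper triangular and
invertible. -/
theorem statement2 (k : ℕ) (hk : 1 ≤ k) (A Γ : Fin k → Fin k → ℂ)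
    (hA : ∀ j i, A j i ≠ 0) (hΓ : ∀ j i, Γ j i ≠ 0) :
    ∃ Q : Matrix (Fin k) (Fin k) (Polynomial ℂ),
      (∀ z : ℂ, z ≠ 0 → ∀ i j : Fin k,
        (Q i j).eval z = z * ((List.ofFn fun m : Fin k => phiB k z (A m) (Γ m)).prod i j)) ∧
      (∀ i j : Fin k, j < i → (Q i j).eval 0 = 0) ∧
      IsUnit (Matrix.of fun i j : Fin k => (Q i j).eval 0) := by
  obtain ⟨n, rfl⟩ : ∃ n, k = n + 1 := ⟨k - 1, by omega⟩
  obtain ⟨C, D, h, -, -, hD, hD'⟩ :=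
    exists_prod_phiB_eq (List.ofFn fun m => (A m, Γ m)) (by simp)
      (List.forall_mem_ofFn_iff.2 hA)
  simp only [List.length_ofFn, List.map_ofFn] at h hD hD'
  refine ⟨Matrix.of fun i j => Polynomial.X * Polynomial.C (C i j) + Polynomial.C (D i j),
    ?_, ?_, ?_⟩
  · intro z hz i j
    have hij := h z hz i j
    simp only [Function.comp_def] at hij
    rw [hij]
    simp
    field_simp
  · intro i j hij
    simpa using hD i j (by simpa using hij)
  · rw [Matrix.isUnit_iff_isUnit_det, Matrix.det_of_isUpperTriangular]
    · simpa [Finset.prod_eq_zero_iff] using fun i => hD' i i rfl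
    · intro i j hij
      simpa using hD i j (by simpa using hij)
end

section
/- Let k ≥ 1, let α, β, γ ∈ ℝ_{>0}^k, and let α', β' be given by the update rule. Then for every z ∈ ℂ with z ∉ {0, β_1⋯β_k, β'_1⋯β'_k}: φ^b(z;α,γ)·φ^g(z;β) = φ^g(z;β')·φ^b(z;α',γ). -/
open scoped BigOperators

/-- The update rule for `α`: `α'_i = α_{i−1}(α_i+γ_{i+1}β_i)/(α_{i−1}+γ_iβ_{i−1})`,
indices taken cyclically in `Fin k`. -/
noncomputable def updA (k : ℕ) [NeZero k] (α β γ : Fin k → ℝ) (i : Fin k) : ℝ :=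
  α (i - 1) * (α i + γ (i + 1) * β i) / (α (i - 1) + γ i * β (i - 1))

/-- The update rule for `β`: `β'_i = β_{i−1}(α_i+γ_{i+1}β_i)/(α_{i−1}+γ_iβ_{i−1})`,
indices taken cyclically in `Fin k`. -/
noncomputable def updB (k : ℕ) [NeZero k] (α β γ : Fin k → ℝ) (i : Fin k) : ℝ :=
  β (i - 1) * (α i + γ (i + 1) * β i) / (α (i - 1) + γ i * β (i - 1))

/-- The twisted cyclic shift: `1` in positions `(i + 1, i)` and `z⁻¹` in the upper right corner. -/
noncomputable def twistedShift (n : ℕ) (z : ℂ) : Matrix (Fin (n + 1)) (Fin (n + 1)) ℂ :=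
  Matrix.of fun i j => if i = j + 1 then (if i = 0 then z⁻¹ else 1) else 0

lemma phiB_eq_diagonal_add (n : ℕ) (z : ℂ) (a c : Fin (n + 1) → ℂ) :
    phiB (n + 1) z a c = Matrix.diagonal c + twistedShift n z * Matrix.diagonal a := by
  ext i j
  rw [Matrix.add_apply, Matrix.mul_diagonal]
  simp only [phiB, twistedShift, Matrix.of_apply, Matrix.diagonal_apply, add_assoc]
  congr 1
  have hj := j.is_lt
  have hi := i.is_lt
  by_cases hjn : j = Fin.last n
  · subst hjn
    have h1 : ¬ ((i : ℕ) = n + 1) := by omega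
    by_cases hi0 : i = 0
    · simp [hi0, mul_comm]
    · have h2 : ¬ ((i : ℕ) = 0) := fun h => hi0 (Fin.ext h)
      simp [hi0, h1, h2]
  · have hjv : ((j + 1 : Fin (n + 1)) : ℕ) = j + 1 := by
      rw [Fin.val_add_one, if_neg hjn]
    have h1 : ¬ ((j : ℕ) = n) := by simpa [Fin.ext_iff] using hjn
    simp only [Fin.ext_iff, hjv, Fin.val_zero]
    by_cases h : (i : ℕ) = j + 1 <;> simp [h, h1]

lemma diagonal_mul_twistedShift (n : ℕ) (z : ℂ) (d : Fin (n + 1) → ℂ) :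
    Matrix.diagonal d * twistedShift n z =
      twistedShift n z * Matrix.diagonal fun j => d (j + 1) := by
  ext i j
  rw [Matrix.diagonal_mul, Matrix.mul_diagonal]
  simp only [twistedShift, Matrix.of_apply]
  by_cases h : i = j + 1
  · rw [← h, mul_comm]
  · simp [h]

lemma twistedShift_mul_diagonal_mul_apply (n : ℕ) (z : ℂ) (b : Fin (n + 1) → ℂ)
    (M : Matrix (Fin (n + 1)) (Fin (n + 1)) ℂ) (i j : Fin (n + 1)) :
    (twistedShift n z * Matrix.diagonal b * M) i j =
      (if i = 0 then z⁻¹ else 1) * b (i - 1) * M (i - 1) j := by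
  rw [Matrix.mul_apply, Finset.sum_eq_single (i - 1)]
  · simp [Matrix.mul_diagonal, twistedShift]
  · intro l _ hl
    have : i ≠ l + 1 := fun h => hl (by simp [h])
    simp [Matrix.mul_diagonal, twistedShift, this]
  · simp

lemma one_sub_mul_phiG (n : ℕ) (z : ℂ) (b : Fin (n + 1) → ℂ) (hz : z ≠ 0) (hb : z ≠ ∏ i, b i) :
    (1 - twistedShift n z * Matrix.diagonal b) * phiG (n + 1) z b = 1 := by
  have hc : 1 - (∏ i, b i) * z⁻¹ ≠ 0 := by
    rw [← div_eq_mul_inv, sub_ne_zero]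
    exact fun h => hb ((div_eq_one_iff_eq hz).1 h.symm).symm
  have hv (i : Fin (n + 1)) : b i = bval b i := by rw [bval, dif_pos i.is_lt]
  have hp : ∏ i, b i = ∏ m ∈ Finset.Ico 0 (n + 1), bval b m := by
    rw [← Finset.range_eq_Ico, ← Fin.prod_univ_eq_prod_range]
    exact Finset.prod_congr rfl fun i _ => hv i
  rw [phiG, Matrix.mul_smul, inv_smul_eq_iff₀ hc]
  ext i j
  rw [sub_mul, one_mul, Matrix.sub_apply, twistedShift_mul_diagonal_mul_apply, Matrix.smul_apply,
    smul_eq_mul, hp, hv]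
  have hj := j.is_lt
  cases i using Fin.cases with
  | zero =>
    have h0 : (0 : Fin (n + 1)) - 1 = Fin.last n := by
      rw [sub_eq_iff_eq_add, Fin.last_add_one]
    have hjn : (j : ℕ) ≤ n := by omega
    simp only [h0, Matrix.of_apply, Fin.val_last, Fin.val_zero, if_true, hjn,
      Finset.prod_Ico_succ_top hjn, Matrix.one_apply, Finset.prod_Ico_succ_top n.zero_le]
    by_cases hj0 : j = 0
    · subst hj0
      simp
      ring
    · have h2 : ¬ ((j : ℕ) = 0) := fun h => hj0 (Fin.ext h)
      simp [h2, Ne.symm hj0]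
      ring
  | succ m =>
    have h0 : m.succ - 1 = m.castSucc := by simp [sub_eq_iff_eq_add]
    simp only [h0, Matrix.of_apply, Fin.val_castSucc, Fin.val_succ, Fin.succ_ne_zero, if_false,
      Matrix.one_apply, one_mul]
    rcases lt_trichotomy (j : ℕ) (m + 1) with h | h | h
    · have h1 : (j : ℕ) ≤ m := by omega
      have h2 : m.succ ≠ j := by rintro rfl; simp at h
      simp [h1, h.le, h2, Finset.prod_Ico_succ_top h1]
      ring
    · have h1 : m.succ = j := Fin.ext (by simp [h])
      have h3 : (m : ℕ) + 1 ≤ n + 1 := by omega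
      rw [← Finset.prod_Ico_consecutive (bval b) (Nat.zero_le _) h3,
        Finset.prod_Ico_succ_top (Nat.zero_le _)]
      simp [h1, h]
      ring
    · have h1 : ¬ (j : ℕ) ≤ m := by omega
      have h2 : m.succ ≠ j := by rintro rfl; simp at h
      have h3 : ¬ (j : ℕ) ≤ m + 1 := by omega
      simp [h1, h3, h2, Finset.prod_range_succ]
      ring

/-- The commutation relation equivalent to the switching rule after inverting both `phiG`. -/
lemma one_sub_mul_phiB (n : ℕ) (z : ℂ) (a b c a' b' : Fin (n + 1) → ℂ)
    (h₁ : ∀ j, a j + c (j + 1) * b j = a' j + c j * b' j)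
    (h₂ : ∀ j, b' (j + 1) * a j = a' (j + 1) * b j) :
    (1 - twistedShift n z * Matrix.diagonal b') * phiB (n + 1) z a c =
      phiB (n + 1) z a' c * (1 - twistedShift n z * Matrix.diagonal b) := by
  have h_quad (u v : Fin (n + 1) → ℂ) :
      twistedShift n z * Matrix.diagonal u * (twistedShift n z * Matrix.diagonal v) =
        twistedShift n z * (twistedShift n z * Matrix.diagonal fun j => u (j + 1) * v j) := by
    rw [Matrix.mul_assoc, ← Matrix.mul_assoc (Matrix.diagonal u), diagonal_mul_twistedShift,
      Matrix.mul_assoc, Matrix.diagonal_mul_diagonal]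
  have h_lin : twistedShift n z * Matrix.diagonal a +
      Matrix.diagonal c * (twistedShift n z * Matrix.diagonal b) =
        twistedShift n z * Matrix.diagonal a' +
          twistedShift n z * Matrix.diagonal b' * Matrix.diagonal c := by
    rw [← Matrix.mul_assoc, diagonal_mul_twistedShift, Matrix.mul_assoc, Matrix.mul_assoc,
      Matrix.diagonal_mul_diagonal, Matrix.diagonal_mul_diagonal, ← Matrix.mul_add,
      ← Matrix.mul_add, Matrix.diagonal_add, Matrix.diagonal_add]
    congr 2
    ext j
    rw [h₁ j, mul_comm (b' j)]
  have h_sq : twistedShift n z * Matrix.diagonal b' * (twistedShift n z * Matrix.diagonal a) =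
      twistedShift n z * Matrix.diagonal a' * (twistedShift n z * Matrix.diagonal b) := by
    simp only [h_quad, h₂]
  rw [phiB_eq_diagonal_add, phiB_eq_diagonal_add, sub_mul, one_mul, mul_sub, mul_one, mul_add,
    add_mul, h_sq, sub_eq_sub_iff_add_eq_add]
  linear_combination (norm := abel) h_lin

/-- The switching rule: `φ^b(z;α,γ)·φ^g(z;β) = φ^g(z;β')·φ^b(z;α',γ)`. -/
theorem statement5 (k : ℕ) [NeZero k] (α β γ : Fin k → ℝ)
    (hα : ∀ i, 0 < α i) (hβ : ∀ i, 0 < β i) (hγ : ∀ i, 0 < γ i)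
    (z : ℂ) (hz0 : z ≠ 0) (hzβ : z ≠ ∏ i, (β i : ℂ))
    (hzβ' : z ≠ ∏ i, (updB k α β γ i : ℂ)) :
    phiB k z (fun i => (α i : ℂ)) (fun i => (γ i : ℂ)) * phiG k z (fun i => (β i : ℂ)) =
      phiG k z (fun i => (updB k α β γ i : ℂ)) *
        phiB k z (fun i => (updA k α β γ i : ℂ)) (fun i => (γ i : ℂ)) := by
  obtain ⟨n, rfl⟩ := Nat.exists_eq_succ_of_ne_zero (NeZero.ne k)
  have h_pos (i : Fin (n + 1)) : α (i - 1) + γ i * β (i - 1) ≠ 0 :=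
    (add_pos (hα _) (mul_pos (hγ _) (hβ _))).ne'
  have hG := one_sub_mul_phiG n z _ hz0 hzβ
  have hG' := mul_eq_one_comm.1 (one_sub_mul_phiG n z _ hz0 hzβ')
  have h_comm := one_sub_mul_phiB n z (fun i => (α i : ℂ)) (fun i => (β i : ℂ))
    (fun i => (γ i : ℂ)) (fun i => (updA (n + 1) α β γ i : ℂ))
    (fun i => (updB (n + 1) α β γ i : ℂ))
    (fun j => by
      have := h_pos j
      norm_cast
      simp only [updA, updB]
      field_simp)
    (fun j => by
      norm_cast
      simp only [updA, updB, add_sub_cancel_right]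
      ring)
  rw [← mul_one (phiB _ z (fun i => (updA (n + 1) α β γ i : ℂ)) _), ← hG,
    ← mul_assoc (phiB _ z _ _), ← h_comm, ← mul_assoc, ← mul_assoc, hG', one_mul]
end

section
/- Assume β^v_i < 1 < α^v_i/γ^v_i for all i = 1,…,ℓ. Let r_s, r_l satisfy max_i β^v_i < r_s < 1 < r_l < min_i α^v_i/γ^v_i, and suppose φ̃_+, φ̃_− are k×k matrix-valued functions such that φ̃_+ and its pointwise inverse are analytic on an open set containing {z : |z| ≤ r_l}, φ̃_− and its pointwise inverse are analytic on an open set containing {z : |z| ≥ r_s} with z^{ℓN} φ̃_−(z) → I as z → ∞, and Φ(z)^{kN} = φ̃_−(z)φ̃_+(z) for all z with r_s ≤ |z| ≤ r_l. Define a matrix K̃, with rows indexed by black labels and columns by white labels, by letting its entry at black label (ℓx+i, ky+j) and white label (ℓx'+i', ky'+j') be the (j'+1, j+1) entry of the k×k matrix −1_{ℓx+i > ℓx'+i'} · (1/2πi) ∮_{|z|=1} (∏_{m=2ℓx'+2i'+2}^{2ℓx+2i} φ_m(z)) z^{y'−y} dz/z + (1/(2πi)²) ∮_{|z₁|=r_s}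 ∮_{|z₂|=r_l} (φ_1(z₁)⋯φ_{2i'+1}(z₁))^{−1} Φ(z₁)^{−x'} φ̃_−(z₁) φ̃_+(z₂) Φ(z₂)^{x−kN} (φ_1(z₂)⋯φ_{2i}(z₂)) · (z₁^{y'}/z₂^{y}) · dz₂ dz₁/(z₂(z₂−z₁)), all circles positively oriented and x, y, x', y' determined by the labels. Then K_{G_Az} · K̃ is the identity matrix; in particular K̃ = K_{G_Az}^{−1}. -/
open scoped BigOperators

/-- The sequence `φ_1, φ_2, φ_3, …` (0-based: `phiSeq m = φ_{m+1}`), extended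
`2ℓ`-periodically: odd-indexed are `φ^b`'s and even-indexed are `φ^g`'s. -/
noncomputable def phiSeq (k ℓ : ℕ) [NeZero ℓ] (α β γ : Fin k → Fin ℓ → ℝ) (z : ℂ) (m : ℕ) :
    Matrix (Fin k) (Fin k) ℂ :=
  let i : Fin ℓ := ⟨(m / 2) % ℓ, Nat.mod_lt _ (Nat.pos_of_neZero ℓ)⟩
  if m % 2 = 0 then phiB k z (fun j => (α j i : ℂ)) (fun j => (γ j i : ℂ))
  else phiG k z (fun j => (β j i : ℂ))

/-- `prodPhiRange … s t = φ_{s+1} φ_{s+2} ⋯ φ_t`, the ordered product of the `φ_m` for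
`m ∈ (s, t]` (1-based); in particular `prodPhiRange … 0 n = φ_1⋯φ_n` and
`prodPhiRange … 0 (2ℓ) = Φ`. -/
noncomputable def prodPhiRange (k ℓ : ℕ) [NeZero ℓ] (α β γ : Fin k → Fin ℓ → ℝ) (z : ℂ)
    (s t : ℕ) : Matrix (Fin k) (Fin k) ℂ :=
  ((List.range (t - s)).map fun u => phiSeq k ℓ α β γ z (s + u)).prod


/-- The Kasteleyn matrix `K_{G_Az}` of the Aztec diamond of size `kℓN`.  A white label
`(a, m)` encodes the white vertex with coordinates `(ℓx+i, ky+j) = (a, m−1)`, and a black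
label `(a', b')` encodes the black vertex with coordinates `(a', b')`. -/
noncomputable def KAz (k ℓ N : ℕ) [NeZero k] [NeZero ℓ] (α β γ : Fin k → Fin ℓ → ℝ) :
    Fin (k * ℓ * N) × Fin (k * ℓ * N + 1) → Fin (k * ℓ * N + 1) × Fin (k * ℓ * N) → ℂ :=
  fun wl bl =>
    let i : Fin ℓ := ⟨(wl.1 : ℕ) % ℓ, Nat.mod_lt _ (Nat.pos_of_neZero ℓ)⟩
    let j : Fin k := ⟨((wl.2 : ℕ) + k - 1) % k, Nat.mod_lt _ (Nat.pos_of_neZero k)⟩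
    if (bl.1 : ℕ) = (wl.1 : ℕ) ∧ (bl.2 : ℕ) = (wl.2 : ℕ) then (α j i : ℂ)
    else if (bl.1 : ℕ) = (wl.1 : ℕ) ∧ (bl.2 : ℕ) + 1 = (wl.2 : ℕ) then (γ j i : ℂ)
    else if (bl.1 : ℕ) = (wl.1 : ℕ) + 1 ∧ (bl.2 : ℕ) = (wl.2 : ℕ) then (β j i : ℂ)
    else if (bl.1 : ℕ) = (wl.1 : ℕ) + 1 ∧ (bl.2 : ℕ) + 1 = (wl.2 : ℕ) then -1
    else 0

/-- The candidate inverse Kasteleyn matrix `K̃`, with rows indexed by black labels and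
columns by white labels, defined by the double contour integral formula of
Theorem 3.1 of Berggren–Duits. -/
noncomputable def Ktil (k ℓ N : ℕ) [NeZero k] [NeZero ℓ] (α β γ : Fin k → Fin ℓ → ℝ)
    (φp φm : ℂ → Matrix (Fin k) (Fin k) ℂ) (rs rl : ℝ) :
    Fin (k * ℓ * N + 1) × Fin (k * ℓ * N) → Fin (k * ℓ * N) × Fin (k * ℓ * N + 1) → ℂ :=
  fun bl wl =>
    let a : ℕ := (bl.1 : ℕ)
    let b : ℕ := (bl.2 : ℕ)
    let a' : ℕ := (wl.1 : ℕ)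
    let m' : ℕ := (wl.2 : ℕ)
    let j : Fin k := ⟨b % k, Nat.mod_lt _ (Nat.pos_of_neZero k)⟩
    let j' : Fin k := ⟨(m' + k - 1) % k, Nat.mod_lt _ (Nat.pos_of_neZero k)⟩
    let y : ℕ := b / k
    let y' : ℤ := Int.fdiv ((m' : ℤ) - 1) k
    (-(if a' < a then (1 : ℂ) else 0)) * (2 * (Real.pi : ℂ) * Complex.I)⁻¹ *
        circleIntegral (fun ζ =>
          (prodPhiRange k ℓ α β γ ζ (2 * a' + 1) (2 * a)) j' j *
            ζ ^ (y' - (y : ℤ)) * ζ⁻¹) 0 1 +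
      ((2 * (Real.pi : ℂ) * Complex.I) ^ 2)⁻¹ *
        circleIntegral (fun z₁ =>
          circleIntegral (fun z₂ =>
            ((prodPhiRange k ℓ α β γ z₁ 0 (2 * (a' % ℓ) + 1))⁻¹ *
              (prodPhiRange k ℓ α β γ z₁ 0 (2 * ℓ)) ^ (-((a' / ℓ : ℕ) : ℤ)) *
              φm z₁ * φp z₂ *
              (prodPhiRange k ℓ α β γ z₂ 0 (2 * ℓ)) ^ (((a / ℓ : ℕ) : ℤ) - (k * N : ℕ)) *
              prodPhiRange k ℓ α β γ z₂ 0 (2 * (a % ℓ))) j' j *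
            z₁ ^ y' * ((z₂ : ℂ) ^ y)⁻¹ * (z₂ * (z₂ - z₁))⁻¹) 0 rl) 0 rs

namespace AztecInverse

open Matrix

section Matrices

variable {k : ℕ} [NeZero k]

lemma mul_phiB_apply (M : Matrix (Fin k) (Fin k) ℂ) (z : ℂ) (α γ : Fin k → ℂ) (p j : Fin k) :
    (M * phiB k z α γ) p j =
      γ j * M p j + α j * (if h : (j : ℕ) + 1 < k then M p ⟨j + 1, h⟩ else z⁻¹ * M p 0) := by
  have hk : 0 < k := Nat.pos_of_neZero k
  simp only [Matrix.mul_apply, phiB, Matrix.of_apply, mul_add, Finset.sum_add_distrib]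
  have h1 : ∑ x, M p x * (if x = j then γ x else 0) = γ j * M p j := by
    simp [mul_comm]
  rw [h1, add_assoc]
  congr 1
  split_ifs with h
  · rw [Finset.sum_eq_single (⟨j + 1, h⟩ : Fin k), Finset.sum_eq_zero]
    · simp [mul_comm]
    · intro x _
      rw [if_neg (by omega), mul_zero]
    · intro x _ hx
      rw [if_neg (fun h' => hx (Fin.ext h')), mul_zero]
    · simp
  · rw [Finset.sum_eq_zero, Finset.sum_eq_single (0 : Fin k)]
    · rw [if_pos ⟨by simp, by omega⟩]; ring
    · intro x _ hx
      rw [if_neg (fun h' => hx (Fin.ext (by simpa using h'.1))), mul_zero]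
    · simp
    · intro x _
      rw [if_neg (by omega), mul_zero]

omit [NeZero k] in
lemma prod_eq_prod_bval (β : Fin k → ℂ) : ∏ i, β i = ∏ m ∈ Finset.Ico 0 k, bval β m := by
  rw [← Finset.range_eq_Ico, Finset.prod_range]
  simp [bval]

/-- `φ^g(z;β)` is inverse to the transition matrix `φ^b(z;-β,1)`. -/
lemma phiG_mul_phiB (z : ℂ) (β : Fin k → ℂ) (hβ : 1 - (∏ i, β i) * z⁻¹ ≠ 0) :
    phiG k z β * phiB k z (fun j => -β j) (fun _ => 1) = 1 := by
  ext p j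
  rw [mul_phiB_apply]
  simp only [phiG, Matrix.smul_apply, Matrix.of_apply, smul_eq_mul, one_mul]
  have hj : bval β j = β j := by simp [bval]
  rw [← hj]
  set c := (1 - (∏ i, β i) * z⁻¹) with hc
  rcases lt_trichotomy (j : ℕ) (p : ℕ) with h | h | h
  · have hjk : (j : ℕ) + 1 < k := by omega
    rw [dif_pos hjk, if_pos h.le, if_pos (show (j : ℕ) + 1 ≤ p by omega),
      Finset.prod_eq_prod_Ico_succ_bot h, Matrix.one_apply_ne (by rintro rfl; omega)]
    ring
  · have hp : p = j := Fin.ext h.symm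
    subst hp
    rw [Matrix.one_apply_eq]
    have key : ∀ X : ℂ, X = bval β p * (∏ m ∈ Finset.Ico ((p : ℕ) + 1) k, bval β m) *
        (∏ m ∈ Finset.Ico 0 (p : ℕ), bval β m) → c = 1 - X * z⁻¹ := by
      intro X hX
      rw [hc, prod_eq_prod_bval, hX, ← Finset.prod_Ico_consecutive _ (Nat.zero_le (p : ℕ)) p.2.le,
        ← Finset.prod_eq_prod_Ico_succ_bot p.2]
      ring
    refine Eq.trans ?_ (inv_mul_cancel₀ hβ)
    generalize c⁻¹ = d
    rw [key _ rfl, if_pos le_rfl]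
    split_ifs with h1 h2 h3
    · omega
    · simp only [Finset.Ico_self, Finset.prod_empty]
      ring
    · have hpk : (p : ℕ) + 1 = k := by omega
      simp only [hpk, Finset.Ico_self, Finset.prod_empty, Fin.val_zero]
      ring
    · simp at h3
  · rw [if_neg (by omega), Matrix.one_apply_ne (by rintro rfl; omega),
      Finset.prod_eq_prod_Ico_succ_bot j.2]
    split_ifs with h1 h2 h3
    · omega
    · ring
    · have : (j : ℕ) + 1 = k := by omega
      simp only [this, Finset.Ico_self, Finset.prod_empty, Fin.val_zero]
      ring
    · simp at h3

omit [NeZero k] in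
lemma phiB_eq_mul_diagonal (z : ℂ) (α γ : Fin k → ℂ) (hγ : ∀ j, γ j ≠ 0) :
    phiB k z α γ = phiB k z (fun j => -(-α j / γ j)) (fun _ => 1) * Matrix.diagonal γ := by
  ext p j
  rw [Matrix.mul_diagonal]
  simp only [phiB, Matrix.of_apply, add_mul, ite_mul, zero_mul, one_mul]
  have h : -(-α j / γ j) * γ j = α j := by field_simp [hγ j]
  have h' : -(-α j / γ j) * z⁻¹ * γ j = α j * z⁻¹ := by rw [mul_right_comm, h]
  rw [h, h']
  congr 2
  split_ifs with h1
  · rw [h1]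
  · rfl

/-- An explicit inverse of `φ^b(z;α,γ)`. -/
lemma invPhiB_mul (z : ℂ) (α γ : Fin k → ℂ) (hγ : ∀ j, γ j ≠ 0)
    (h : 1 - (∏ i, (-α i / γ i)) * z⁻¹ ≠ 0) :
    (Matrix.diagonal (fun j => (γ j)⁻¹) * phiG k z (fun j => -α j / γ j)) * phiB k z α γ = 1 := by
  rw [phiB_eq_mul_diagonal z α γ hγ, Matrix.mul_assoc, ← Matrix.mul_assoc (phiG _ _ _),
    phiG_mul_phiB z _ h, Matrix.one_mul, Matrix.diagonal_mul_diagonal, ← Matrix.diagonal_one]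
  congr 1
  ext j
  exact inv_mul_cancel₀ (hγ j)

/-- The residue modulo `k` of an integer, as an element of `Fin k`. -/
def residue (k : ℕ) [NeZero k] (b : ℤ) : Fin k :=
  ⟨(b % k).toNat, by
    have hk : (0 : ℤ) < k := by exact_mod_cast Nat.pos_of_neZero k
    have := Int.emod_nonneg b hk.ne'
    have := Int.emod_lt_of_pos b hk
    omega⟩

lemma residue_val (b : ℤ) : ((residue k b : ℕ) : ℤ) = b % k := by
  have hk : (0 : ℤ) < k := by exact_mod_cast Nat.pos_of_neZero k
  simpa [residue] using Int.emod_nonneg b (ne_of_gt hk)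

/-- The column of the block Toeplitz matrix with symbol `M` at position `b`: the column of `M`
at the residue of `b`, shifted by the corresponding power of `z`. -/
noncomputable def colAt (M : Matrix (Fin k) (Fin k) ℂ) (z : ℂ) (b : ℤ) (p : Fin k) : ℂ :=
  M p (residue k b) * z ^ (-(b / (k : ℤ)))

lemma colAt_mul_phiB (M : Matrix (Fin k) (Fin k) ℂ) (z : ℂ) (hz : z ≠ 0) (α γ : Fin k → ℂ)
    (b : ℤ) (p : Fin k) :
    colAt (M * phiB k z α γ) z b p =
      α (residue k b) * colAt M z (b + 1) p + γ (residue k b) * colAt M z b p := by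
  have hk : (0 : ℤ) < k := by exact_mod_cast Nat.pos_of_neZero k
  have hr := residue_val (k := k) b
  have hr' := residue_val (k := k) (b + 1)
  have h0 := Int.emod_nonneg b hk.ne'
  have h1 := Int.emod_lt_of_pos b hk
  have h2 := Int.mul_ediv_add_emod b k
  simp only [colAt, mul_phiB_apply]
  split_ifs with h
  · have hlt : b % k + 1 < k := by omega
    have hd : (b + 1) / (k : ℤ) = b / k ∧ (b + 1) % (k : ℤ) = b % k + 1 := by
      rw [Int.ediv_emod_unique hk]
      exact ⟨by linarith, by omega, hlt⟩
    rw [hd.1]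
    have : residue k (b + 1) = ⟨residue k b + 1, h⟩ := Fin.ext (by simp only; omega)
    rw [this]
    ring
  · have hlt : b % k + 1 = k := by omega
    have hd : (b + 1) / (k : ℤ) = b / k + 1 ∧ (b + 1) % (k : ℤ) = 0 := by
      rw [Int.ediv_emod_unique hk]
      refine ⟨by rw [mul_add]; linarith, le_rfl, hk⟩
    rw [hd.1]
    have : residue k (b + 1) = 0 := Fin.ext (by simp only [Fin.val_zero]; omega)
    rw [this, neg_add, zpow_add₀ hz, _root_.zpow_neg_one]
    ring

end Matrices

section Order

variable {R : ℝ} {k : ℕ} [NeZero k]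

/-- `f` has order at least `e` at the origin: on the punctured disc of radius `R` it is `z ^ e`
times a function which is holomorphic on the whole disc. -/
def HasOrd (R : ℝ) (e : ℤ) (f : ℂ → ℂ) : Prop :=
  ∃ g : ℂ → ℂ, DifferentiableOn ℂ g (Metric.closedBall 0 R) ∧
    ∀ z ∈ Metric.closedBall (0 : ℂ) R, z ≠ 0 → f z = z ^ e * g z

lemma HasOrd.mul {e e' : ℤ} {f f' : ℂ → ℂ} (h : HasOrd R e f) (h' : HasOrd R e' f') :
    HasOrd R (e + e') (fun z => f z * f' z) := by
  obtain ⟨g, hg, hfg⟩ := h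
  obtain ⟨g', hg', hfg'⟩ := h'
  refine ⟨fun z => g z * g' z, hg.mul hg', fun z hz hz0 => ?_⟩
  simp only [hfg z hz hz0, hfg' z hz hz0, zpow_add₀ hz0]
  ring

lemma HasOrd.mono {e e' : ℤ} {f : ℂ → ℂ} (h : HasOrd R e f) (hle : e' ≤ e) : HasOrd R e' f := by
  obtain ⟨g, hg, hfg⟩ := h
  refine ⟨fun z => z ^ (e - e').toNat * g z, (differentiableOn_id.pow _).mul hg,
    fun z hz hz0 => ?_⟩
  rw [hfg z hz hz0, ← mul_assoc, ← zpow_natCast, ← zpow_add₀ hz0]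
  congr 2
  omega

lemma HasOrd.add {e : ℤ} {f f' : ℂ → ℂ} (h : HasOrd R e f) (h' : HasOrd R e f') :
    HasOrd R e (fun z => f z + f' z) := by
  obtain ⟨g, hg, hfg⟩ := h
  obtain ⟨g', hg', hfg'⟩ := h'
  refine ⟨fun z => g z + g' z, hg.add hg', fun z hz hz0 => ?_⟩
  simp only [hfg z hz hz0, hfg' z hz hz0]
  ring

lemma hasOrd_zero (e : ℤ) : HasOrd R e (fun _ => 0) :=
  ⟨fun _ => 0, differentiableOn_const 0, fun z _ _ => by simp⟩

lemma hasOrd_const (c : ℂ) : HasOrd R 0 (fun _ => c) :=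
  ⟨fun _ => c, differentiableOn_const c, fun z _ _ => by simp⟩

lemma hasOrd_zpow (n : ℤ) : HasOrd R n (fun z => z ^ n) :=
  ⟨fun _ => 1, differentiableOn_const 1, fun z _ _ => by simp⟩

lemma HasOrd.sum {ι : Type*} (s : Finset ι) {e : ℤ} {f : ι → ℂ → ℂ}
    (h : ∀ i ∈ s, HasOrd R e (f i)) : HasOrd R e (fun z => ∑ i ∈ s, f i z) := by
  classical
  induction s using Finset.induction_on with
  | empty => simpa using hasOrd_zero e
  | insert i s hi ih =>
    simp only [Finset.sum_insert hi]
    exact (h i (Finset.mem_insert_self i s)).add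
      (ih fun j hj => h j (Finset.mem_insert_of_mem hj))

/-- The least order at the origin allowed for the `(p,q)` entry of a matrix of level `s`. -/
def entryOrd (k : ℕ) (s : ℤ) (p q : Fin k) : ℤ := -(((q : ℕ) - (p : ℕ) - s) / (k : ℤ))

/-- A matrix function whose block Toeplitz matrix is supported at distance at least `s`
from the diagonal. -/
def MatOrd (R : ℝ) (s : ℤ) (F : ℂ → Matrix (Fin k) (Fin k) ℂ) : Prop :=
  ∀ p q, HasOrd R (entryOrd k s p q) (fun z => F z p q)

lemma entryOrd_le {s : ℤ} {p q : Fin k} {n : ℤ} (h : (p : ℕ) - (q : ℕ) + s ≤ n * k) :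
    entryOrd k s p q ≤ n := by
  have hk : (0 : ℤ) < k := by exact_mod_cast Nat.pos_of_neZero k
  have : -n ≤ ((q : ℕ) - (p : ℕ) - s) / (k : ℤ) := by
    rw [Int.le_ediv_iff_mul_le hk]
    linarith
  unfold entryOrd
  linarith

lemma le_entryOrd {s : ℤ} {p q : Fin k} {n : ℤ} (h : (n - 1) * k < (p : ℕ) - (q : ℕ) + s) :
    n ≤ entryOrd k s p q := by
  have hk : (0 : ℤ) < k := by exact_mod_cast Nat.pos_of_neZero k
  have : ((q : ℕ) - (p : ℕ) - s) / (k : ℤ) < -n + 1 := by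
    rw [Int.ediv_lt_iff_lt_mul hk]
    linarith
  unfold entryOrd
  linarith

lemma MatOrd.mul {s t : ℤ} {F G : ℂ → Matrix (Fin k) (Fin k) ℂ} (hF : MatOrd R s F)
    (hG : MatOrd R t G) : MatOrd R (s + t) (fun z => F z * G z) := by
  intro p q
  simp only [Matrix.mul_apply]
  refine HasOrd.sum _ fun r _ => ((hF p r).mul (hG r q)).mono (entryOrd_le ?_)
  have hk : (0 : ℤ) < k := by exact_mod_cast Nat.pos_of_neZero k
  have h1 := Int.ediv_mul_le ((r : ℕ) - (p : ℕ) - s : ℤ) hk.ne'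
  have h2 := Int.ediv_mul_le ((q : ℕ) - (r : ℕ) - t : ℤ) hk.ne'
  unfold entryOrd
  linarith

lemma matOrd_diagonal (d : Fin k → ℂ) : MatOrd R 0 (fun _ => Matrix.diagonal d) := by
  intro p q
  by_cases h : p = q
  · subst h
    exact (hasOrd_const _).mono (entryOrd_le (by simp))
  · simp only [Matrix.diagonal_apply_ne _ h]
    exact hasOrd_zero _

lemma matOrd_phiB (α γ : Fin k → ℂ) : MatOrd R (-1) (fun z => phiB k z α γ) := by
  intro p q
  simp only [phiB, Matrix.of_apply]
  refine ((?_ : HasOrd R _ _).add ?_).add ?_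
  · split_ifs with h
    · subst h
      exact (hasOrd_const _).mono (entryOrd_le (by simp))
    · exact hasOrd_zero _
  · split_ifs with h
    · exact (hasOrd_const _).mono (entryOrd_le (by omega))
    · exact hasOrd_zero _
  · split_ifs with h
    · have : HasOrd R (0 + -1) (fun z => α q * z ^ (-1 : ℤ)) := (hasOrd_const _).mul (hasOrd_zpow _)
      simp only [_root_.zpow_neg_one] at this
      have := q.2
      exact HasOrd.mono ‹HasOrd R _ _› (entryOrd_le (by omega))
    · exact hasOrd_zero _

lemma matOrd_phiG (β : Fin k → ℂ) (hβ : R < ‖∏ i, β i‖) : MatOrd R 1 (fun z => phiG k z β) := by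
  intro p q
  have hinv : HasOrd R 1 (fun z => (1 - (∏ i, β i) * z⁻¹)⁻¹) := by
    have hne : ∀ z ∈ Metric.closedBall (0 : ℂ) R, z - ∏ i, β i ≠ 0 := by
      intro z hz h
      rw [sub_eq_zero] at h
      rw [mem_closedBall_zero_iff, h] at hz
      linarith
    refine ⟨fun z => (z - ∏ i, β i)⁻¹, ?_, fun z hz hz0 => ?_⟩
    · exact (differentiableOn_id.sub_const _).inv hne
    · have := hne z hz
      rw [zpow_one, ← div_eq_mul_inv, inv_eq_iff_eq_inv, inv_div, sub_div, div_self hz0,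
        div_eq_mul_inv]
  simp only [phiG, Matrix.smul_apply, Matrix.of_apply, smul_eq_mul]
  have hp := p.2
  have hq := q.2
  split_ifs with h
  · exact (hinv.mul (hasOrd_const _)).mono (entryOrd_le (by omega))
  · have : HasOrd R (1 + (-1 + 0 + 0)) (fun z => (1 - (∏ i, β i) * z⁻¹)⁻¹ * (z ^ (-1 : ℤ) *
        (∏ m ∈ Finset.Ico (q : ℕ) k, bval β m) * ∏ m ∈ Finset.Ico 0 (p : ℕ), bval β m)) :=
      hinv.mul (((hasOrd_zpow _).mul (hasOrd_const _)).mul (hasOrd_const _))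
    simp only [_root_.zpow_neg_one] at this
    exact HasOrd.mono this (entryOrd_le (by omega))

/-- A function of nonnegative order has vanishing integral over the boundary circle. -/
lemma HasOrd.circleIntegral_eq_zero {r : ℝ} (hr : 0 < r) (hrR : r ≤ R) {f : ℂ → ℂ}
    (h : HasOrd R 0 f) : (∮ z in C(0, r), f z) = 0 := by
  obtain ⟨g, hg, hfg⟩ := h
  have hsub := Metric.closedBall_subset_closedBall hrR (x := (0 : ℂ))
  have hcongr : (∮ z in C(0, r), f z) = ∮ z in C(0, r), g z := by
    refine circleIntegral.integral_congr hr.le fun z hz => ?_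
    have hz0 : z ≠ 0 := by
      rintro rfl
      simp at hz
      exact hr.ne hz
    simpa using hfg z (hsub (Metric.sphere_subset_closedBall hz)) hz0
  rw [hcongr]
  refine Complex.circleIntegral_eq_zero_of_differentiable_on_off_countable hr.le
    Set.countable_empty (hg.mono hsub).continuousOn fun z hz => ?_
  exact (hg.mono hsub).differentiableAt
    (Metric.closedBall_mem_nhds_of_mem hz.1)

/-- Cauchy's integral formula for a function of nonnegative order. -/
lemma HasOrd.circleIntegral_sub_inv {f : ℂ → ℂ} (h : HasOrd R 0 f) {w : ℂ} (hw : w ≠ 0)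
    (hwR : ‖w‖ < R) : (∮ z in C(0, R), f z * (z - w)⁻¹) = 2 * Real.pi * Complex.I * f w := by
  obtain ⟨g, hg, hfg⟩ := h
  have hR : 0 < R := (norm_nonneg w).trans_lt hwR
  have hcongr : (∮ z in C(0, R), f z * (z - w)⁻¹) = ∮ z in C(0, R), (z - w)⁻¹ • g z := by
    refine circleIntegral.integral_congr hR.le fun z hz => ?_
    have hz0 : z ≠ 0 := by
      rintro rfl
      simp at hz
      exact hR.ne hz
    have := hfg z (Metric.sphere_subset_closedBall hz) hz0
    simp only [this, zpow_zero, one_mul, smul_eq_mul]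
    ring
  rw [hcongr, hg.circleIntegral_sub_inv_smul (by simpa using hwR), hfg w (by simpa using hwR.le) hw]
  simp

end Order

section Contour

/-- A function holomorphic outside a disc and `o(1/z)` at infinity integrates to zero. -/
lemma circleIntegral_eq_zero_of_tendsto {r : ℝ} (hr : 0 < r) {f : ℂ → ℂ}
    (hf : ∀ z, r ≤ ‖z‖ → DifferentiableAt ℂ f z)
    (hlim : Filter.Tendsto (fun z => z * f z) (Bornology.cobounded ℂ) (nhds 0)) :
    (∮ z in C(0, r), f z) = 0 := by
  rw [← norm_le_zero_iff]
  refine le_of_forall_pos_le_add fun ε hε => ?_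
  rw [zero_add]
  have hev := (Metric.tendsto_nhds.1 hlim (ε / (2 * Real.pi)) (by positivity))
  rw [Filter.HasBasis.eventually_iff (Metric.hasBasis_cobounded_compl_closedBall (0 : ℂ))] at hev
  obtain ⟨S, -, hS⟩ := hev
  set T := max r (S + 1)
  have hT : 0 < T := hr.trans_le (le_max_left _ _)
  have heq : (∮ z in C(0, T), f z) = ∮ z in C(0, r), f z := by
    refine Complex.circleIntegral_eq_of_differentiable_on_annulus_off_countable hr
      (le_max_left _ _) Set.countable_empty (fun z hz => ?_) fun z hz => ?_
    · exact (hf z (by simpa using hz.2)).continuousAt.continuousWithinAt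
    · refine hf z (le_of_lt ?_)
      simpa using hz.1.2
  rw [← heq]
  refine (circleIntegral.norm_integral_le_of_norm_le_const hT.le
    (C := ε / (2 * Real.pi) / T) fun z hz => ?_).trans_eq ?_
  · have hzT : ‖z‖ = T := by simpa using hz
    have hzS : z ∈ (Metric.closedBall (0 : ℂ) S)ᶜ := by
      have : S + 1 ≤ T := le_max_right _ _
      simp only [Set.mem_compl_iff, mem_closedBall_zero_iff, hzT, not_le]
      linarith
    have := hS hzS
    simp only [dist_zero_right, norm_mul, hzT] at this
    rw [le_div_iff₀ hT, mul_comm]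
    exact this.le
  · field_simp

lemma circleIntegral_eq_of_differentiableAt {r R : ℝ} (hr : 0 < r) (hrR : r ≤ R) {f : ℂ → ℂ}
    (hf : ∀ z, r ≤ ‖z‖ → DifferentiableAt ℂ f z) :
    (∮ z in C(0, R), f z) = ∮ z in C(0, r), f z := by
  refine Complex.circleIntegral_eq_of_differentiable_on_annulus_off_countable hr
    hrR Set.countable_empty (fun z hz => ?_) fun z hz => ?_
  · exact (hf z (by simpa using hz.2)).continuousAt.continuousWithinAt
  · refine hf z (le_of_lt ?_)
    simpa using hz.1.2

lemma circleIntegral_linear_combination {r : ℝ} (hr : 0 ≤ r) {f₁ f₂ f₃ f₄ F : ℂ → ℂ}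
    {c₁ c₂ c₃ c₄ : ℂ}
    (h₁ : ContinuousOn f₁ (Metric.sphere 0 r)) (h₂ : ContinuousOn f₂ (Metric.sphere 0 r))
    (h₃ : ContinuousOn f₃ (Metric.sphere 0 r)) (h₄ : ContinuousOn f₄ (Metric.sphere 0 r))
    (hF : ∀ z ∈ Metric.sphere (0 : ℂ) r, c₁ * f₁ z + c₂ * f₂ z + c₃ * f₃ z + c₄ * f₄ z = F z) :
    c₁ * (∮ z in C(0, r), f₁ z) + c₂ * (∮ z in C(0, r), f₂ z) + c₃ * (∮ z in C(0, r), f₃ z) +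
      c₄ * (∮ z in C(0, r), f₄ z) = ∮ z in C(0, r), F z := by
  have add {f g : ℂ → ℂ} (hf : ContinuousOn f (Metric.sphere 0 r))
      (hg : ContinuousOn g (Metric.sphere 0 r)) :
      (∮ z in C(0, r), (f z + g z)) = (∮ z in C(0, r), f z) + ∮ z in C(0, r), g z :=
    circleIntegral.integral_add (hf.circleIntegrable hr) (hg.circleIntegrable hr)
  rw [← circleIntegral.integral_congr hr hF, add (by fun_prop) (by fun_prop),
    add (by fun_prop) (by fun_prop), add (by fun_prop) (by fun_prop)]
  simp only [circleIntegral.integral_const_mul]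

/-- The Cauchy-type transform `w ↦ ∮_{|z|=R} f(z) dz / (z (z - w))`. -/
noncomputable def cauchyTransform (R : ℝ) (f : ℂ → ℂ) (w : ℂ) : ℂ :=
  ∮ z in C(0, R), f z * (z * (z - w))⁻¹

lemma continuousOn_cauchyKernel {R : ℝ} {f : ℂ → ℂ}
    (hf : ContinuousOn f (Metric.sphere 0 R)) {w : ℂ} (hw : ‖w‖ < R) :
    ContinuousOn (fun z => f z * (z * (z - w))⁻¹) (Metric.sphere 0 R) := by
  refine hf.mul (ContinuousOn.inv₀ (by fun_prop) fun z hz => ?_)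
  have hz' : ‖z‖ = R := by simpa using hz
  refine mul_ne_zero ?_ (sub_ne_zero.2 ?_)
  · rintro rfl
    have := norm_nonneg w
    simp at hz'
    linarith
  · rintro rfl
    linarith

lemma continuousOn_cauchyTransform {r R : ℝ} (hr : 0 ≤ r) (hrR : r < R) {f : ℂ → ℂ}
    (hf : ContinuousOn f (Metric.sphere 0 R)) :
    ContinuousOn (cauchyTransform R f) (Metric.sphere 0 r) := by
  have hR : 0 < R := hr.trans_lt hrR
  lift R to NNReal using hR.le
  have hf' : ContinuousOn (fun z => f z * z⁻¹) (Metric.sphere 0 (R : ℝ)) := by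
    refine hf.mul (continuousOn_id.inv₀ fun z hz => ?_)
    rintro rfl
    simp at hz
    simp [← hz] at hR
  have h := (hasFPowerSeriesOn_cauchy_integral (hf'.circleIntegrable hR.le)
    (by exact_mod_cast hR)).continuousOn
  have h2 : Set.EqOn (cauchyTransform R f) (fun w => (2 * Real.pi * Complex.I : ℂ) *
      ((2 * Real.pi * Complex.I : ℂ)⁻¹ • ∮ z in C(0, R), (z - w)⁻¹ • (f z * z⁻¹)))
      (Metric.sphere 0 r) := by
    intro w _
    simp only [smul_eq_mul, mul_inv_cancel_left₀ Complex.two_pi_I_ne_zero]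
    refine circleIntegral.integral_congr hR.le fun z _ => ?_
    simp only [mul_inv]
    ring
  refine ContinuousOn.congr (ContinuousOn.mul continuousOn_const (h.mono ?_)) h2
  intro w hw
  have : ‖w‖ = r := by simpa using hw
  rw [Metric.mem_eball, edist_zero_right, enorm_eq_nnnorm]
  exact_mod_cast (show ‖w‖ < R by linarith)

end Contour

lemma one_sub_mul_inv_ne_zero {c z : ℂ} (hz : z ≠ 0) (h : ‖c‖ ≠ ‖z‖) : 1 - c * z⁻¹ ≠ 0 := by
  intro h0
  rw [sub_eq_zero, eq_comm, ← div_eq_mul_inv, div_eq_one_iff_eq hz] at h0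
  exact h (by rw [h0])

section Sequences

variable {k ℓ : ℕ} [NeZero ℓ] {α β γ : Fin k → Fin ℓ → ℝ}

/-- The residue modulo `ℓ` of a natural number. -/
def colIdx (ℓ : ℕ) [NeZero ℓ] (a : ℕ) : Fin ℓ := ⟨a % ℓ, Nat.mod_lt _ (Nat.pos_of_neZero ℓ)⟩

lemma phiSeq_even (z : ℂ) (a : ℕ) : phiSeq k ℓ α β γ z (2 * a) =
    phiB k z (fun j => (α j (colIdx ℓ a) : ℂ)) (fun j => (γ j (colIdx ℓ a) : ℂ)) := by
  simp [phiSeq, colIdx]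

lemma phiSeq_odd (z : ℂ) (a : ℕ) : phiSeq k ℓ α β γ z (2 * a + 1) =
    phiG k z (fun j => (β j (colIdx ℓ a) : ℂ)) := by
  have h : (2 * a + 1) / 2 = a := by omega
  simp [phiSeq, colIdx, h]

lemma phiSeq_add_period (z : ℂ) (m : ℕ) :
    phiSeq k ℓ α β γ z (2 * ℓ + m) = phiSeq k ℓ α β γ z m := by
  have h1 : (2 * ℓ + m) / 2 = ℓ + m / 2 := by omega
  have h2 : (2 * ℓ + m) % 2 = m % 2 := by omega
  simp only [phiSeq, h1, h2, Nat.add_mod_left]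

lemma prodPhiRange_self (z : ℂ) (s : ℕ) : prodPhiRange k ℓ α β γ z s s = 1 := by
  simp [prodPhiRange]

lemma prodPhiRange_succ (z : ℂ) (s n : ℕ) : prodPhiRange k ℓ α β γ z s (s + n + 1) =
    prodPhiRange k ℓ α β γ z s (s + n) * phiSeq k ℓ α β γ z (s + n) := by
  have h1 : s + n + 1 - s = n + 1 := by omega
  have h2 : s + n - s = n := by omega
  simp [prodPhiRange, h1, h2, List.range_succ]

lemma prodPhiRange_succ_of_le (z : ℂ) {s t : ℕ} (h : s ≤ t) : prodPhiRange k ℓ α β γ z s (t + 1) =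
    prodPhiRange k ℓ α β γ z s t * phiSeq k ℓ α β γ z t := by
  obtain ⟨n, rfl⟩ := Nat.exists_eq_add_of_le h
  exact prodPhiRange_succ z s n

lemma prodPhiRange_mul (z : ℂ) {s t u : ℕ} (hst : s ≤ t) (htu : t ≤ u) :
    prodPhiRange k ℓ α β γ z s t * prodPhiRange k ℓ α β γ z t u =
      prodPhiRange k ℓ α β γ z s u := by
  induction u, htu using Nat.le_induction with
  | base => rw [prodPhiRange_self, mul_one]
  | succ u hu ih =>
    rw [prodPhiRange_succ_of_le z hu, prodPhiRange_succ_of_le z (hst.trans hu), ← mul_assoc, ih]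

lemma prodPhiRange_add_period (z : ℂ) (t : ℕ) :
    prodPhiRange k ℓ α β γ z 0 (2 * ℓ + t) =
      prodPhiRange k ℓ α β γ z 0 (2 * ℓ) * prodPhiRange k ℓ α β γ z 0 t := by
  induction t with
  | zero => rw [prodPhiRange_self, mul_one, add_zero]
  | succ t ih =>
    rw [← add_assoc, prodPhiRange_succ_of_le z (Nat.zero_le _),
      prodPhiRange_succ_of_le z (Nat.zero_le t), ih, phiSeq_add_period, mul_assoc]

lemma prodPhiRange_mul_period (z : ℂ) (n t : ℕ) :
    prodPhiRange k ℓ α β γ z 0 (2 * ℓ) ^ n * prodPhiRange k ℓ α β γ z 0 t =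
      prodPhiRange k ℓ α β γ z 0 (2 * ℓ * n + t) := by
  induction n with
  | zero => simp
  | succ n ih =>
    rw [pow_succ', mul_assoc, ih, ← prodPhiRange_add_period]
    congr 1
    ring

/-- The explicit inverses of the transition matrices `phiSeq`. -/
noncomputable def invPhiSeq (k ℓ : ℕ) [NeZero ℓ] (α β γ : Fin k → Fin ℓ → ℝ) (z : ℂ) (m : ℕ) :
    Matrix (Fin k) (Fin k) ℂ :=
  if m % 2 = 0 then
    Matrix.diagonal (fun j => (γ j (colIdx ℓ (m / 2)) : ℂ)⁻¹) *
      phiG k z (fun j => -(α j (colIdx ℓ (m / 2)) : ℂ) / (γ j (colIdx ℓ (m / 2)) : ℂ))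
  else phiB k z (fun j => -(β j (colIdx ℓ (m / 2)) : ℂ)) (fun _ => 1)

/-- The explicit inverse of `φ_{s+1} ⋯ φ_{s+n}`. -/
noncomputable def invProd (k ℓ : ℕ) [NeZero ℓ] (α β γ : Fin k → Fin ℓ → ℝ) (z : ℂ) (s : ℕ) :
    ℕ → Matrix (Fin k) (Fin k) ℂ
  | 0 => 1
  | n + 1 => invPhiSeq k ℓ α β γ z (s + n) * invProd k ℓ α β γ z s n

variable [NeZero k] {rs rl : ℝ}

omit [NeZero ℓ] [NeZero k] in
lemma norm_prod_beta (hβ : ∀ j i, 0 < β j i) (i : Fin ℓ) : ‖∏ j, (β j i : ℂ)‖ = ∏ j, β j i := by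
  rw [← Complex.ofReal_prod, Complex.norm_real, Real.norm_of_nonneg]
  exact Finset.prod_nonneg fun j _ => (hβ j i).le

omit [NeZero ℓ] [NeZero k] in
lemma norm_prod_alpha_div (hα : ∀ j i, 0 < α j i) (hγ : ∀ j i, 0 < γ j i) (i : Fin ℓ) :
    ‖∏ j, (-(α j i : ℂ) / (γ j i : ℂ))‖ = (∏ j, α j i) / (∏ j, γ j i) := by
  rw [norm_prod, ← Finset.prod_div_distrib]
  refine Finset.prod_congr rfl fun j _ => ?_
  rw [norm_div, norm_neg, Complex.norm_real, Complex.norm_real, Real.norm_of_nonneg (hα j i).le,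
    Real.norm_of_nonneg (hγ j i).le]

lemma phiSeq_odd_mul_phiB (hβ : ∀ j i, 0 < β j i) (hrs : ∀ i : Fin ℓ, (∏ j, β j i) < rs)
    (hrs0 : 0 < rs) {z : ℂ} (hz : rs ≤ ‖z‖) (a : ℕ) :
    phiSeq k ℓ α β γ z (2 * a + 1) *
      phiB k z (fun j => -(β j (colIdx ℓ a) : ℂ)) (fun _ => 1) = 1 := by
  rw [phiSeq_odd]
  refine phiG_mul_phiB z _ (one_sub_mul_inv_ne_zero (norm_pos_iff.1 (hrs0.trans_le hz)) ?_)
  rw [norm_prod_beta hβ]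
  exact ((hrs _).trans_le hz).ne

lemma invPhiSeq_mul (hα : ∀ j i, 0 < α j i) (hβ : ∀ j i, 0 < β j i) (hγ : ∀ j i, 0 < γ j i)
    (hrs : ∀ i : Fin ℓ, (∏ j, β j i) < rs)
    (hrl : ∀ i : Fin ℓ, rl < (∏ j, α j i) / (∏ j, γ j i)) (hrs0 : 0 < rs)
    {z : ℂ} (hz : rs ≤ ‖z‖) (hz' : ‖z‖ ≤ rl) (m : ℕ) :
    invPhiSeq k ℓ α β γ z m * phiSeq k ℓ α β γ z m = 1 := by
  have hz0 : z ≠ 0 := norm_pos_iff.1 (hrs0.trans_le hz)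
  rcases Nat.even_or_odd' m with ⟨a, rfl | rfl⟩
  · have h1 : 2 * a / 2 = a := by omega
    rw [invPhiSeq, if_pos (by omega), phiSeq_even, h1]
    refine invPhiB_mul z _ _ (fun j => by exact_mod_cast (hγ _ _).ne')
      (one_sub_mul_inv_ne_zero hz0 ?_)
    rw [norm_prod_alpha_div hα hγ]
    exact (hz'.trans_lt (hrl _)).ne'
  · have h1 : (2 * a + 1) / 2 = a := by omega
    rw [invPhiSeq, if_neg (by omega), h1]
    exact mul_eq_one_comm.1 (phiSeq_odd_mul_phiB hβ hrs hrs0 hz a)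

lemma invProd_mul (hα : ∀ j i, 0 < α j i) (hβ : ∀ j i, 0 < β j i) (hγ : ∀ j i, 0 < γ j i)
    (hrs : ∀ i : Fin ℓ, (∏ j, β j i) < rs)
    (hrl : ∀ i : Fin ℓ, rl < (∏ j, α j i) / (∏ j, γ j i)) (hrs0 : 0 < rs)
    {z : ℂ} (hz : rs ≤ ‖z‖) (hz' : ‖z‖ ≤ rl) (s n : ℕ) :
    invProd k ℓ α β γ z s n * prodPhiRange k ℓ α β γ z s (s + n) = 1 := by
  induction n with
  | zero => simp [invProd, prodPhiRange_self]
  | succ n ih =>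
    rw [← add_assoc, prodPhiRange_succ, invProd, Matrix.mul_assoc,
      ← Matrix.mul_assoc (invProd k ℓ α β γ z s n), ih, Matrix.one_mul,
      invPhiSeq_mul hα hβ hγ hrs hrl hrs0 hz hz']

lemma matOrd_invProd (hα : ∀ j i, 0 < α j i) (hγ : ∀ j i, 0 < γ j i)
    (hrl : ∀ i : Fin ℓ, rl < (∏ j, α j i) / (∏ j, γ j i)) (a n : ℕ) :
    MatOrd rl ((n : ℤ) % 2) (fun z => invProd k ℓ α β γ z (2 * a) n) := by
  induction n with
  | zero =>
    have := matOrd_diagonal (R := rl) (k := k) (fun _ => 1)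
    simpa [invProd] using this
  | succ n ih =>
    simp only [invProd]
    rcases Nat.even_or_odd' n with ⟨b, rfl | rfl⟩
    · have h1 : (((2 * b + 1 : ℕ) : ℤ) % 2) = (0 + 1) + ((2 * b : ℕ) : ℤ) % 2 := by omega
      rw [h1]
      refine MatOrd.mul ?_ ih
      simp only [invPhiSeq, if_pos (show (2 * a + 2 * b) % 2 = 0 by omega)]
      refine (matOrd_diagonal _).mul (matOrd_phiG _ ?_)
      rw [norm_prod_alpha_div hα hγ]
      exact hrl _
    · have h1 : (((2 * b + 1 + 1 : ℕ) : ℤ) % 2) = -1 + ((2 * b + 1 : ℕ) : ℤ) % 2 := by omega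
      rw [h1]
      refine MatOrd.mul ?_ ih
      simp only [invPhiSeq, if_neg (show ¬ (2 * a + (2 * b + 1)) % 2 = 0 by omega)]
      exact matOrd_phiB _ _

omit [NeZero k] in
lemma differentiableAt_phiSeq (hβ : ∀ j i, 0 < β j i) (hrs : ∀ i : Fin ℓ, (∏ j, β j i) < rs)
    (hrs0 : 0 < rs) {z : ℂ} (hz : rs ≤ ‖z‖) (m : ℕ) (p q : Fin k) :
    DifferentiableAt ℂ (fun z => phiSeq k ℓ α β γ z m p q) z := by
  have hz0 : z ≠ 0 := norm_pos_iff.1 (hrs0.trans_le hz)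
  have hinv : DifferentiableAt ℂ (fun z : ℂ => z⁻¹) z := differentiableAt_inv hz0
  rcases Nat.even_or_odd' m with ⟨a, rfl | rfl⟩
  · simp only [phiSeq_even, phiB, Matrix.of_apply]
    split_ifs <;> fun_prop
  · simp only [phiSeq_odd, phiG, Matrix.of_apply, Matrix.smul_apply, smul_eq_mul]
    refine DifferentiableAt.mul (DifferentiableAt.inv (by fun_prop)
      (one_sub_mul_inv_ne_zero hz0 ?_)) ?_
    · rw [norm_prod_beta hβ]
      exact ((hrs _).trans_le hz).ne
    · split_ifs <;> fun_prop

omit [NeZero k] in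
lemma differentiableAt_prodPhiRange (hβ : ∀ j i, 0 < β j i)
    (hrs : ∀ i : Fin ℓ, (∏ j, β j i) < rs)
    (hrs0 : 0 < rs) {z : ℂ} (hz : rs ≤ ‖z‖) (s t : ℕ) (p q : Fin k) :
    DifferentiableAt ℂ (fun z => prodPhiRange k ℓ α β γ z s t p q) z := by
  simp only [prodPhiRange]
  generalize t - s = n
  induction n generalizing p q with
  | zero => simp
  | succ n ih =>
    simp only [List.range_succ, List.map_append, List.prod_append, List.map_singleton,
      List.prod_singleton, Matrix.mul_apply]
    exact DifferentiableAt.fun_sum fun r _ => (ih p r).mul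
      (differentiableAt_phiSeq hβ hrs hrs0 hz _ r q)

omit [NeZero k] in
lemma isBigO_phiSeq (m : ℕ) (p q : Fin k) :
    (fun z => phiSeq k ℓ α β γ z m p q) =O[Bornology.cobounded ℂ] (fun _ => (1 : ℂ)) := by
  have hinv : Filter.Tendsto (fun z : ℂ => z⁻¹) (Bornology.cobounded ℂ) (nhds 0) :=
    Filter.tendsto_inv₀_cobounded
  have hinv' := hinv.isBigO_one ℂ
  have hc (c : ℂ) : (fun _ : ℂ => c) =O[Bornology.cobounded ℂ] (fun _ => (1 : ℂ)) :=
    Asymptotics.isBigO_const_const _ one_ne_zero _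
  have hmul {f g : ℂ → ℂ} (hf : f =O[Bornology.cobounded ℂ] (fun _ => (1 : ℂ)))
      (hg : g =O[Bornology.cobounded ℂ] (fun _ => (1 : ℂ))) :
      (fun z => f z * g z) =O[Bornology.cobounded ℂ] (fun _ => (1 : ℂ)) := by
    simpa using hf.mul hg
  rcases Nat.even_or_odd' m with ⟨a, rfl | rfl⟩
  · simp only [phiSeq_even, phiB, Matrix.of_apply]
    refine ((hc _).add (hc _)).add ?_
    split_ifs
    · exact hmul (hc _) hinv'
    · exact hc _
  · simp only [phiSeq_odd, phiG, Matrix.of_apply, Matrix.smul_apply, smul_eq_mul]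
    refine hmul ?_ ?_
    · have h1 : Filter.Tendsto (fun z : ℂ => 1 - (∏ j, (β j (colIdx ℓ a) : ℂ)) * z⁻¹)
          (Bornology.cobounded ℂ) (nhds (1 - (∏ j, (β j (colIdx ℓ a) : ℂ)) * 0)) :=
        tendsto_const_nhds.sub (hinv.const_mul _)
      exact (h1.inv₀ (by simp)).isBigO_one ℂ
    · split_ifs
      · exact hc _
      · exact hmul (hmul hinv' (hc _)) (hc _)

omit [NeZero k] in
lemma isBigO_prodPhiRange (s t : ℕ) (p q : Fin k) :
    (fun z => prodPhiRange k ℓ α β γ z s t p q) =O[Bornology.cobounded ℂ]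
      (fun _ => (1 : ℂ)) := by
  simp only [prodPhiRange]
  generalize t - s = n
  induction n generalizing p q with
  | zero => exact Asymptotics.isBigO_const_const _ one_ne_zero _
  | succ n ih =>
    simp only [List.range_succ, List.map_append, List.prod_append, List.map_singleton,
      List.prod_singleton, Matrix.mul_apply]
    refine Asymptotics.IsBigO.fun_sum fun r _ => ?_
    simpa using (ih p r).mul (isBigO_phiSeq (s + n) r q)

end Sequences

/-- The standing assumptions on the weights and on the Wiener–Hopf factors. -/
structure WienerHopf (k ℓ N : ℕ) [NeZero k] [NeZero ℓ] (α β γ : Fin k → Fin ℓ → ℝ)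
    (φp φm : ℂ → Matrix (Fin k) (Fin k) ℂ) (rs rl : ℝ) : Prop where
  α_pos : ∀ j i, 0 < α j i
  β_pos : ∀ j i, 0 < β j i
  γ_pos : ∀ j i, 0 < γ j i
  rs_pos : 0 < rs
  lt_rs : ∀ i : Fin ℓ, (∏ j, β j i) < rs
  rs_lt_one : rs < 1
  one_lt_rl : 1 < rl
  rl_lt : ∀ i : Fin ℓ, rl < (∏ j, α j i) / (∏ j, γ j i)
  diff_plus : ∀ p q, DifferentiableOn ℂ (fun z => φp z p q) (Metric.closedBall 0 rl)
  diff_minus : ∀ z, rs ≤ ‖z‖ → ∀ p q, DifferentiableAt ℂ (fun z => φm z p q) z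
  diff_minus_inv : ∀ z, rs ≤ ‖z‖ → ∀ p q, DifferentiableAt ℂ (fun z => (φm z)⁻¹ p q) z
  tendsto_minus : ∀ p q : Fin k, Filter.Tendsto (fun z : ℂ => z ^ (ℓ * N) * φm z p q)
      (Bornology.cobounded ℂ) (nhds ((1 : Matrix (Fin k) (Fin k) ℂ) p q))
  factor : ∀ z : ℂ, rs ≤ ‖z‖ → ‖z‖ ≤ rl →
      (prodPhiRange k ℓ α β γ z 0 (2 * ℓ)) ^ (k * N) = φm z * φp z

section Kernel

variable {k ℓ N : ℕ} [NeZero k] [NeZero ℓ] {α β γ : Fin k → Fin ℓ → ℝ}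
  {φp φm : ℂ → Matrix (Fin k) (Fin k) ℂ} {rs rl : ℝ}

lemma HasOrd.continuousOn_sphere {r R : ℝ} (hr : 0 < r) (hrR : r ≤ R) {e : ℤ} {f : ℂ → ℂ}
    (h : HasOrd R e f) : ContinuousOn f (Metric.sphere 0 r) := by
  obtain ⟨g, hg, hfg⟩ := h
  have hsub : Metric.sphere (0 : ℂ) r ⊆ Metric.closedBall 0 R :=
    Metric.sphere_subset_closedBall.trans (Metric.closedBall_subset_closedBall hrR)
  have hne : ∀ z ∈ Metric.sphere (0 : ℂ) r, z ≠ 0 := by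
    rintro z hz rfl
    simp at hz
    exact hr.ne hz
  refine ContinuousOn.congr (f := fun z => z ^ e * g z) ?_ fun z hz => hfg z (hsub hz) (hne z hz)
  exact (continuousOn_id.zpow₀ e fun z hz => Or.inl (hne z hz)).mul (hg.continuousOn.mono hsub)

lemma differentiableAt_colAt {F : ℂ → Matrix (Fin k) (Fin k) ℂ} {z : ℂ} (hz : z ≠ 0)
    (hF : ∀ p q, DifferentiableAt ℂ (fun z => F z p q) z) (b : ℤ) (p : Fin k) :
    DifferentiableAt ℂ (fun z => colAt (F z) z b p) z :=
  (hF p _).mul (differentiableAt_zpow.2 (Or.inl hz))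

lemma tendsto_zpow_cobounded {n : ℤ} (hn : n < 0) :
    Filter.Tendsto (fun z : ℂ => z ^ n) (Bornology.cobounded ℂ) (nhds 0) := by
  obtain ⟨m, rfl⟩ : ∃ m : ℕ, n = -((m + 1 : ℕ) : ℤ) := ⟨(-n - 1).toNat, by omega⟩
  have h : Filter.Tendsto (fun z : ℂ => z⁻¹ ^ (m + 1)) (Bornology.cobounded ℂ)
      (nhds (0 ^ (m + 1))) := Filter.tendsto_inv₀_cobounded.pow (m + 1)
  simpa only [_root_.zpow_neg, _root_.zpow_natCast, inv_pow, zero_pow (Nat.succ_ne_zero m)] using h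

/-- The integrand of the single contour integral. The black vertex is `(a, b)`, the white vertex
is `(a', c)`. -/
noncomputable def singleIntegrand (α β γ : Fin k → Fin ℓ → ℝ) (a : ℕ) (b : ℤ) (a' : ℕ) (c : ℤ)
    (ζ : ℂ) : ℂ :=
  if a' < a then
    colAt (prodPhiRange k ℓ α β γ ζ (2 * a' + 1) (2 * a)) ζ b (residue k c) *
      (ζ ^ (c / (k : ℤ)) * ζ⁻¹)
  else 0

/-- The row vector in the first variable of the double contour integral. -/
noncomputable def rowKernel (α β γ : Fin k → Fin ℓ → ℝ) (φm : ℂ → Matrix (Fin k) (Fin k) ℂ)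
    (a' : ℕ) (c : ℤ) (p : Fin k) (w : ℂ) : ℂ :=
  ((prodPhiRange k ℓ α β γ w 0 (2 * a' + 1))⁻¹ * φm w) (residue k c) p * w ^ (c / (k : ℤ))

/-- The column vector in the second variable of the double contour integral. -/
noncomputable def colKernel (α β γ : Fin k → Fin ℓ → ℝ) (φm : ℂ → Matrix (Fin k) (Fin k) ℂ)
    (a : ℕ) (b : ℤ) (p : Fin k) (z : ℂ) : ℂ :=
  colAt ((φm z)⁻¹ * prodPhiRange k ℓ α β γ z 0 (2 * a)) z b p

/-- The outer integrand of the double contour integral. -/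
noncomputable def doubleIntegrand (α β γ : Fin k → Fin ℓ → ℝ)
    (φm : ℂ → Matrix (Fin k) (Fin k) ℂ) (rl : ℝ) (a : ℕ) (b : ℤ) (a' : ℕ) (c : ℤ) (w : ℂ) : ℂ :=
  ∑ p, rowKernel α β γ φm a' c p w * cauchyTransform rl (colKernel α β γ φm a b p) w

/-- The inverse Kasteleyn matrix, extended to black vertices of arbitrary height. -/
noncomputable def extKtil (α β γ : Fin k → Fin ℓ → ℝ) (φm : ℂ → Matrix (Fin k) (Fin k) ℂ)
    (rs rl : ℝ) (a : ℕ) (b : ℤ) (a' : ℕ) (c : ℤ) : ℂ :=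
  -(2 * (Real.pi : ℂ) * Complex.I)⁻¹ * (∮ ζ in C(0, 1), singleIntegrand α β γ a b a' c ζ) +
    ((2 * (Real.pi : ℂ) * Complex.I) ^ 2)⁻¹ *
      (∮ w in C(0, rs), doubleIntegrand α β γ φm rl a b a' c w)

namespace WienerHopf

variable (H : WienerHopf k ℓ N α β γ φp φm rs rl)

include H

lemma ne_zero {z : ℂ} (hz : rs ≤ ‖z‖) : z ≠ 0 := norm_pos_iff.1 (H.rs_pos.trans_le hz)

lemma rs_lt_rl : rs < rl := H.rs_lt_one.trans H.one_lt_rl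

lemma rl_pos : 0 < rl := H.rs_pos.trans H.rs_lt_rl

lemma inv_prodPhiRange {z : ℂ} (hz : rs ≤ ‖z‖) (hz' : ‖z‖ ≤ rl) (s n : ℕ) :
    (prodPhiRange k ℓ α β γ z s (s + n))⁻¹ = invProd k ℓ α β γ z s n :=
  Matrix.inv_eq_left_inv (invProd_mul H.α_pos H.β_pos H.γ_pos H.lt_rs H.rl_lt H.rs_pos hz hz' s n)

lemma isUnit_det_prodPhiRange {z : ℂ} (hz : rs ≤ ‖z‖) (hz' : ‖z‖ ≤ rl) {s t : ℕ} (hst : s ≤ t) :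
    IsUnit (prodPhiRange k ℓ α β γ z s t).det := by
  obtain ⟨n, rfl⟩ := Nat.exists_eq_add_of_le hst
  exact Matrix.isUnit_det_of_left_inverse
    (invProd_mul H.α_pos H.β_pos H.γ_pos H.lt_rs H.rl_lt H.rs_pos hz hz' s n)

lemma isUnit_det_minus {z : ℂ} (hz : rs ≤ ‖z‖) (hz' : ‖z‖ ≤ rl) : IsUnit (φm z).det := by
  have h := (H.isUnit_det_prodPhiRange hz hz' (Nat.zero_le (2 * ℓ))).pow (k * N)
  rw [← Matrix.det_pow, H.factor z hz hz', Matrix.det_mul] at h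
  exact isUnit_of_mul_isUnit_left h

lemma plus_eq {z : ℂ} (hz : rs ≤ ‖z‖) (hz' : ‖z‖ ≤ rl) :
    φp z = (φm z)⁻¹ * prodPhiRange k ℓ α β γ z 0 (2 * ℓ) ^ (k * N) := by
  rw [H.factor z hz hz', Matrix.nonsing_inv_mul_cancel_left _ _ (H.isUnit_det_minus hz hz')]

lemma differentiableAt_colKernel {z : ℂ} (hz : rs ≤ ‖z‖) (a : ℕ) (b : ℤ) (p : Fin k) :
    DifferentiableAt ℂ (colKernel α β γ φm a b p) z := by
  refine differentiableAt_colAt (H.ne_zero hz) (fun p q => ?_) b p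
  simp only [Matrix.mul_apply]
  exact DifferentiableAt.fun_sum fun r _ => (H.diff_minus_inv z hz p r).mul
    (differentiableAt_prodPhiRange H.β_pos H.lt_rs H.rs_pos hz _ _ r q)

lemma continuousOn_colKernel (a : ℕ) (b : ℤ) (p : Fin k) :
    ContinuousOn (colKernel α β γ φm a b p) (Metric.sphere 0 rl) := by
  intro z hz
  have hz' : ‖z‖ = rl := by simpa using hz
  exact (H.differentiableAt_colKernel (by rw [hz']; exact H.rs_lt_rl.le) a b
    p).continuousAt.continuousWithinAt

lemma continuousOn_rowKernel (a' : ℕ) (c : ℤ) (p : Fin k) :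
    ContinuousOn (rowKernel α β γ φm a' c p) (Metric.sphere 0 rs) := by
  have hsph : ∀ z ∈ Metric.sphere (0 : ℂ) rs, ‖z‖ = rs := fun z hz => by simpa using hz
  have hM := matOrd_invProd (k := k) (β := β) H.α_pos H.γ_pos H.rl_lt 0 (2 * a' + 1)
  refine ContinuousOn.mul (ContinuousOn.congr (f := fun w =>
    (invProd k ℓ α β γ w (2 * 0) (2 * a' + 1) * φm w) (residue k c) p) ?_ fun w hw => ?_) ?_
  · simp only [Matrix.mul_apply]
    refine continuousOn_finsetSum _ fun q _ =>
      ((hM _ q).continuousOn_sphere H.rs_pos H.rs_lt_rl.le).mul fun w hw => ?_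
    exact (H.diff_minus w (hsph w hw).ge q p).continuousAt.continuousWithinAt
  · have := H.inv_prodPhiRange (hsph w hw).ge ((hsph w hw).le.trans H.rs_lt_rl.le) 0 (2 * a' + 1)
    rw [zero_add] at this
    simp only [this, mul_zero]
  · exact continuousOn_id.zpow₀ _ fun w hw => Or.inl (H.ne_zero (hsph w hw).ge)

lemma continuousOn_doubleIntegrand (a : ℕ) (b : ℤ) (a' : ℕ) (c : ℤ) :
    ContinuousOn (doubleIntegrand α β γ φm rl a b a' c) (Metric.sphere 0 rs) :=
  continuousOn_finsetSum _ fun p _ => (H.continuousOn_rowKernel a' c p).mul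
    (continuousOn_cauchyTransform H.rs_pos.le H.rs_lt_rl (H.continuousOn_colKernel a b p))

lemma differentiableAt_singleIntegrand {z : ℂ} (hz : rs ≤ ‖z‖) (a : ℕ) (b : ℤ) (a' : ℕ) (c : ℤ) :
    DifferentiableAt ℂ (singleIntegrand α β γ a b a' c) z := by
  have hz0 := H.ne_zero hz
  unfold singleIntegrand
  split_ifs
  · refine (differentiableAt_colAt hz0 (fun p q => ?_) b _).mul
      ((differentiableAt_zpow.2 (Or.inl hz0)).mul (differentiableAt_inv hz0))
    exact differentiableAt_prodPhiRange H.β_pos H.lt_rs H.rs_pos hz _ _ p q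
  · exact differentiableAt_const 0

lemma continuousOn_singleIntegrand (a : ℕ) (b : ℤ) (a' : ℕ) (c : ℤ) :
    ContinuousOn (singleIntegrand α β γ a b a' c) (Metric.sphere 0 1) := by
  intro z hz
  have hz' : ‖z‖ = 1 := by simpa using hz
  exact (H.differentiableAt_singleIntegrand (by rw [hz']; exact H.rs_lt_one.le) a b a'
    c).continuousAt.continuousWithinAt

/-- The local relation between the columns of the transfer matrices at adjacent vertices. -/
lemma colAt_relation (M : Matrix (Fin k) (Fin k) ℂ) {z : ℂ} (hz : rs ≤ ‖z‖) {s a : ℕ}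
    (hs : s ≤ 2 * a) (b : ℤ) (p : Fin k) :
    (α (residue k b) (colIdx ℓ a) : ℂ) *
        colAt (M * prodPhiRange k ℓ α β γ z s (2 * a)) z (b + 1) p +
      (γ (residue k b) (colIdx ℓ a) : ℂ) *
        colAt (M * prodPhiRange k ℓ α β γ z s (2 * a)) z b p +
      (β (residue k b) (colIdx ℓ a) : ℂ) *
        colAt (M * prodPhiRange k ℓ α β γ z s (2 * (a + 1))) z (b + 1) p +
      (-1) * colAt (M * prodPhiRange k ℓ α β γ z s (2 * (a + 1))) z b p = 0 := by
  have h1 := colAt_mul_phiB (M * prodPhiRange k ℓ α β γ z s (2 * a)) z (H.ne_zero hz)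
    (fun j => (α j (colIdx ℓ a) : ℂ)) (fun j => (γ j (colIdx ℓ a) : ℂ)) b p
  have h2 := colAt_mul_phiB (M * prodPhiRange k ℓ α β γ z s (2 * (a + 1))) z (H.ne_zero hz)
    (fun j => -(β j (colIdx ℓ a) : ℂ)) (fun _ => 1) b p
  have h3 : prodPhiRange k ℓ α β γ z s (2 * (a + 1)) *
      phiB k z (fun j => -(β j (colIdx ℓ a) : ℂ)) (fun _ => 1) =
      prodPhiRange k ℓ α β γ z s (2 * a) *
        phiB k z (fun j => (α j (colIdx ℓ a) : ℂ)) (fun j => (γ j (colIdx ℓ a) : ℂ)) := by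
    rw [show 2 * (a + 1) = 2 * a + 1 + 1 by ring, prodPhiRange_succ_of_le z (by omega),
      prodPhiRange_succ_of_le z hs, Matrix.mul_assoc,
      phiSeq_odd_mul_phiB H.β_pos H.lt_rs H.rs_pos hz, Matrix.mul_one, phiSeq_even]
  rw [Matrix.mul_assoc, h3, ← Matrix.mul_assoc, h1] at h2
  linear_combination h2

lemma doubleIntegral_relation (a : ℕ) (b : ℤ) (a' : ℕ) (c : ℤ) :
    (α (residue k b) (colIdx ℓ a) : ℂ) *
        (∮ w in C(0, rs), doubleIntegrand α β γ φm rl a (b + 1) a' c w) +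
      (γ (residue k b) (colIdx ℓ a) : ℂ) *
        (∮ w in C(0, rs), doubleIntegrand α β γ φm rl a b a' c w) +
      (β (residue k b) (colIdx ℓ a) : ℂ) *
        (∮ w in C(0, rs), doubleIntegrand α β γ φm rl (a + 1) (b + 1) a' c w) +
      (-1) * (∮ w in C(0, rs), doubleIntegrand α β γ φm rl (a + 1) b a' c w) = 0 := by
  rw [circleIntegral_linear_combination (F := fun _ => 0) H.rs_pos.le
    (H.continuousOn_doubleIntegrand _ _ _ _) (H.continuousOn_doubleIntegrand _ _ _ _)
    (H.continuousOn_doubleIntegrand _ _ _ _) (H.continuousOn_doubleIntegrand _ _ _ _)]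
  · simp [circleIntegral]
  intro w hw
  have hw' : ‖w‖ < rl := by
    have : ‖w‖ = rs := by simpa using hw
    rw [this]
    exact H.rs_lt_rl
  simp only [doubleIntegrand, Finset.mul_sum, ← Finset.sum_add_distrib]
  refine Finset.sum_eq_zero fun p _ => ?_
  have key := circleIntegral_linear_combination (F := fun _ => 0) H.rl_pos.le
    (c₁ := α (residue k b) (colIdx ℓ a)) (c₂ := γ (residue k b) (colIdx ℓ a))
    (c₃ := β (residue k b) (colIdx ℓ a)) (c₄ := -1)
    (continuousOn_cauchyKernel (H.continuousOn_colKernel a (b + 1) p) hw')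
    (continuousOn_cauchyKernel (H.continuousOn_colKernel a b p) hw')
    (continuousOn_cauchyKernel (H.continuousOn_colKernel (a + 1) (b + 1) p) hw')
    (continuousOn_cauchyKernel (H.continuousOn_colKernel (a + 1) b p) hw') (fun z hz => by
      have hz' : ‖z‖ = rl := by simpa using hz
      have hrel := H.colAt_relation (φm z)⁻¹ (hz'.symm ▸ H.rs_lt_rl.le : rs ≤ ‖z‖)
        (Nat.zero_le (2 * a)) b p
      unfold colKernel
      linear_combination (z * (z - w))⁻¹ * hrel)
  have hzero : (∮ _z in C(0, rl), (0 : ℂ)) = 0 := by simp [circleIntegral]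
  rw [hzero] at key
  unfold cauchyTransform
  linear_combination rowKernel α β γ φm a' c p w * key

lemma singleIntegral_relation (a : ℕ) (b : ℤ) (a' : ℕ) (c : ℤ) :
    (α (residue k b) (colIdx ℓ a) : ℂ) *
        (∮ ζ in C(0, 1), singleIntegrand α β γ a (b + 1) a' c ζ) +
      (γ (residue k b) (colIdx ℓ a) : ℂ) * (∮ ζ in C(0, 1), singleIntegrand α β γ a b a' c ζ) +
      (β (residue k b) (colIdx ℓ a) : ℂ) *
        (∮ ζ in C(0, 1), singleIntegrand α β γ (a + 1) (b + 1) a' c ζ) +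
      (-1) * (∮ ζ in C(0, 1), singleIntegrand α β γ (a + 1) b a' c ζ) =
    -(if a = a' ∧ b = c then 2 * (Real.pi : ℂ) * Complex.I else 0) := by
  have hsph : ∀ z ∈ Metric.sphere (0 : ℂ) 1, rs ≤ ‖z‖ := fun z hz => by
    have : ‖z‖ = 1 := by simpa using hz
    rw [this]
    exact H.rs_lt_one.le
  by_cases haa : a = a'
  · subst haa
    rw [circleIntegral_linear_combination
      (F := fun ζ => -(1 : Matrix (Fin k) (Fin k) ℂ) (residue k c) (residue k b) *
        (ζ - 0) ^ (c / (k : ℤ) - b / (k : ℤ) - 1)) zero_le_one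
      (H.continuousOn_singleIntegrand _ _ _ _) (H.continuousOn_singleIntegrand _ _ _ _)
      (H.continuousOn_singleIntegrand _ _ _ _) (H.continuousOn_singleIntegrand _ _ _ _)]
    · rw [circleIntegral.integral_const_mul]
      by_cases hbc : b = c
      · subst hbc
        simp only [and_self, if_true, Matrix.one_apply_eq, sub_self, zero_sub,
          _root_.zpow_neg_one]
        rw [circleIntegral.integral_sub_inv_of_mem_ball (by simp)]
        ring
      · rw [if_neg (by tauto)]
        by_cases hr : residue k c = residue k b
        · rw [circleIntegral.integral_sub_zpow_of_ne]
          · simp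
          · intro hq
            apply hbc
            have h1 := residue_val (k := k) b
            have h2 := residue_val (k := k) c
            rw [hr] at h2
            rw [← Int.mul_ediv_add_emod b k, ← Int.mul_ediv_add_emod c k, ← h1, ← h2,
              show b / (k : ℤ) = c / (k : ℤ) by omega]
        · rw [Matrix.one_apply_ne hr]
          simp
    · intro ζ hζ
      have hζ0 := H.ne_zero (hsph ζ hζ)
      simp only [singleIntegrand, lt_irrefl, if_false, Nat.lt_succ_self, if_true]
      have h2 := colAt_mul_phiB (prodPhiRange k ℓ α β γ ζ (2 * a + 1) (2 * (a + 1))) ζ hζ0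
        (fun j => -(β j (colIdx ℓ a) : ℂ)) (fun _ => 1) b (residue k c)
      have h3 : prodPhiRange k ℓ α β γ ζ (2 * a + 1) (2 * (a + 1)) =
          phiSeq k ℓ α β γ ζ (2 * a + 1) := by
        rw [show 2 * (a + 1) = 2 * a + 1 + 1 by ring, prodPhiRange_succ_of_le ζ le_rfl,
          prodPhiRange_self, Matrix.one_mul]
      rw [h3, phiSeq_odd_mul_phiB H.β_pos H.lt_rs H.rs_pos (hsph ζ hζ)] at h2
      have h4 : ζ ^ (c / (k : ℤ) - b / (k : ℤ) - 1) =
          ζ ^ (-(b / (k : ℤ))) * (ζ ^ (c / (k : ℤ)) * ζ⁻¹) := by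
        rw [← _root_.zpow_neg_one, ← zpow_add₀ hζ0, ← zpow_add₀ hζ0]
        congr 1
        ring
      rw [sub_zero, h4, h3]
      rw [colAt] at h2
      linear_combination (ζ ^ (c / (k : ℤ)) * ζ⁻¹) * h2
  · rw [if_neg (by tauto), circleIntegral_linear_combination (F := fun _ => 0) zero_le_one
      (H.continuousOn_singleIntegrand _ _ _ _) (H.continuousOn_singleIntegrand _ _ _ _)
      (H.continuousOn_singleIntegrand _ _ _ _) (H.continuousOn_singleIntegrand _ _ _ _)]
    · simp [circleIntegral]
    intro ζ hζ
    by_cases hlt : a' < a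
    · have hrel := H.colAt_relation 1 (hsph ζ hζ) (show 2 * a' + 1 ≤ 2 * a by omega) b
        (residue k c)
      simp only [Matrix.one_mul] at hrel
      simp only [singleIntegrand, if_pos hlt, if_pos (show a' < a + 1 by omega)]
      linear_combination (ζ ^ (c / (k : ℤ)) * ζ⁻¹) * hrel
    · simp only [singleIntegrand, if_neg hlt, if_neg (show ¬ a' < a + 1 by omega), mul_zero,
        add_zero]

lemma extKtil_relation (a : ℕ) (b : ℤ) (a' : ℕ) (c : ℤ) :
    (α (residue k b) (colIdx ℓ a) : ℂ) * extKtil α β γ φm rs rl a (b + 1) a' c +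
      (γ (residue k b) (colIdx ℓ a) : ℂ) * extKtil α β γ φm rs rl a b a' c +
      (β (residue k b) (colIdx ℓ a) : ℂ) * extKtil α β γ φm rs rl (a + 1) (b + 1) a' c +
      (-1) * extKtil α β γ φm rs rl (a + 1) b a' c = if a = a' ∧ b = c then 1 else 0 := by
  have h1 := H.singleIntegral_relation a b a' c
  have h2 := H.doubleIntegral_relation a b a' c
  have h3 : (if a = a' ∧ b = c then (1 : ℂ) else 0) = (2 * (Real.pi : ℂ) * Complex.I)⁻¹ *
      (if a = a' ∧ b = c then 2 * (Real.pi : ℂ) * Complex.I else 0) := by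
    split_ifs
    · rw [inv_mul_cancel₀ Complex.two_pi_I_ne_zero]
    · simp
  rw [h3]
  unfold extKtil
  linear_combination (-(2 * (Real.pi : ℂ) * Complex.I)⁻¹) * h1 +
    ((2 * (Real.pi : ℂ) * Complex.I) ^ 2)⁻¹ * h2

end WienerHopf
end Kernel

lemma neg_one_ediv {k : ℤ} (hk : 0 < k) : (-1) / k = -1 := by
  refine le_antisymm (Int.lt_add_one_iff.1 ?_) ((Int.le_ediv_iff_mul_le hk).2 (by omega))
  rw [Int.ediv_lt_iff_lt_mul hk]
  omega

section Boundary

variable {k ℓ N : ℕ} [NeZero k] [NeZero ℓ] {α β γ : Fin k → Fin ℓ → ℝ}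
  {φp φm : ℂ → Matrix (Fin k) (Fin k) ℂ} {rs rl : ℝ}

namespace WienerHopf

variable (H : WienerHopf k ℓ N α β γ φp φm rs rl)

include H

lemma isBigO_inv_minus (p q : Fin k) :
    (fun z => z ^ (-((ℓ * N : ℕ) : ℤ)) * (φm z)⁻¹ p q) =O[Bornology.cobounded ℂ]
      (fun _ => (1 : ℂ)) := by
  have h1 : Filter.Tendsto (fun z : ℂ => z ^ (ℓ * N) • φm z) (Bornology.cobounded ℂ)
      (nhds (1 : Matrix (Fin k) (Fin k) ℂ)) :=
    tendsto_pi_nhds.2 fun p => tendsto_pi_nhds.2 fun q => by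
      simpa using H.tendsto_minus p q
  have h2 : ContinuousAt (Inv.inv : Matrix (Fin k) (Fin k) ℂ → _) 1 := by
    refine continuousAt_matrix_inv _ ?_
    rw [Ring.inverse_eq_inv']
    exact continuousAt_inv₀ (by simp)
  have h3 := h2.tendsto.comp h1
  have h4 := (tendsto_pi_nhds.1 (tendsto_pi_nhds.1 h3 p) q).isBigO_one ℂ
  refine h4.congr' ?_ Filter.EventuallyEq.rfl
  filter_upwards [Bornology.eventually_ne_cobounded (0 : ℂ)] with z hz
  have hu : IsUnit (z ^ (ℓ * N)) := (pow_ne_zero _ hz).isUnit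
  have h5 : (z ^ (ℓ * N) • φm z)⁻¹ = (z ^ (ℓ * N))⁻¹ • (φm z)⁻¹ := by
    by_cases hd : IsUnit (φm z).det
    · refine Matrix.inv_eq_left_inv ?_
      rw [Matrix.smul_mul, Matrix.mul_smul, smul_smul, inv_mul_cancel₀ hu.ne_zero, one_smul,
        Matrix.nonsing_inv_mul _ hd]
    · rw [Matrix.nonsing_inv_apply_not_isUnit _ hd, Matrix.nonsing_inv_apply_not_isUnit, smul_zero]
      rw [Matrix.det_smul]
      exact fun h => hd (isUnit_of_mul_isUnit_right h)
  simp only [Function.comp_apply, h5, Matrix.smul_apply, smul_eq_mul, _root_.zpow_neg,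
    _root_.zpow_natCast]

/-- The extended inverse Kasteleyn matrix vanishes just above the Aztec diamond. -/
lemma extKtil_top (a a' : ℕ) (c : ℤ) (hc : c < k * ℓ * N) :
    extKtil α β γ φm rs rl a (k * ℓ * N : ℕ) a' c = 0 := by
  have hk : (0 : ℤ) < k := by exact_mod_cast Nat.pos_of_neZero k
  have hdiv : ((k * ℓ * N : ℕ) : ℤ) / (k : ℤ) = (ℓ * N : ℕ) := by
    rw [mul_assoc, Nat.cast_mul, Int.mul_ediv_cancel_left _ hk.ne']
  have hcdiv : c / (k : ℤ) < (ℓ * N : ℕ) := by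
    rw [Int.ediv_lt_iff_lt_mul hk]
    push_cast
    linarith
  have hsingle : (∮ ζ in C(0, 1), singleIntegrand α β γ a (k * ℓ * N : ℕ) a' c ζ) = 0 := by
    refine circleIntegral_eq_zero_of_tendsto one_pos (fun z hz =>
      H.differentiableAt_singleIntegrand (H.rs_lt_one.le.trans hz) _ _ _ _) ?_
    unfold singleIntegrand
    split_ifs
    · have h1 := (isBigO_prodPhiRange (k := k) (α := α) (β := β) (γ := γ) (2 * a' + 1) (2 * a)
        (residue k c) (residue k (k * ℓ * N : ℕ))).mul_isLittleO
        ((Asymptotics.isLittleO_one_iff ℂ).2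
          (tendsto_zpow_cobounded (show c / (k : ℤ) - (ℓ * N : ℕ) < 0 by linarith)))
      simp only [mul_one] at h1
      refine ((Asymptotics.isLittleO_one_iff ℂ).1 h1).congr' ?_
      filter_upwards [Bornology.eventually_ne_cobounded (0 : ℂ)] with z hz
      rw [colAt, hdiv, zpow_sub₀ hz, _root_.zpow_neg]
      field_simp
    · simp
  have hdouble : ∀ w ∈ Metric.sphere (0 : ℂ) rs,
      doubleIntegrand α β γ φm rl a (k * ℓ * N : ℕ) a' c w = 0 := by
    intro w hw
    have hw' : ‖w‖ < rl := by
      have : ‖w‖ = rs := by simpa using hw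
      rw [this]
      exact H.rs_lt_rl
    refine Finset.sum_eq_zero fun p _ => mul_eq_zero_of_right _ ?_
    refine circleIntegral_eq_zero_of_tendsto H.rl_pos (fun z hz => ?_) ?_
    · have hz0 := H.ne_zero (H.rs_lt_rl.le.trans hz)
      refine (H.differentiableAt_colKernel (H.rs_lt_rl.le.trans hz) _ _ _).mul
        (DifferentiableAt.inv (by fun_prop) (mul_ne_zero hz0 (sub_ne_zero.2 ?_)))
      rintro rfl
      linarith
    · have hinv : Filter.Tendsto (fun z : ℂ => (z - w)⁻¹) (Bornology.cobounded ℂ) (nhds 0) :=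
        Filter.tendsto_inv₀_cobounded.comp (by simp)
      have h1 : (fun z => ∑ q, z ^ (-((ℓ * N : ℕ) : ℤ)) * (φm z)⁻¹ p q *
          prodPhiRange k ℓ α β γ z 0 (2 * a) q (residue k (k * ℓ * N : ℕ)))
          =O[Bornology.cobounded ℂ] (fun _ => (1 : ℂ)) :=
        Asymptotics.IsBigO.fun_sum fun q _ => by
          simpa using (H.isBigO_inv_minus p q).mul (isBigO_prodPhiRange _ _ q _)
      have h2 := h1.mul_isLittleO ((Asymptotics.isLittleO_one_iff ℂ).2 hinv)
      simp only [mul_one] at h2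
      refine ((Asymptotics.isLittleO_one_iff ℂ).1 h2).congr' ?_
      filter_upwards [Bornology.eventually_ne_cobounded (0 : ℂ)] with z hz
      rw [colKernel, colAt, hdiv, Matrix.mul_apply, mul_inv, mul_left_comm, ← mul_assoc z,
        mul_inv_cancel₀ hz, one_mul]
      simp only [Finset.sum_mul]
      exact Finset.sum_congr rfl fun q _ => by ring
  have hdouble' : (∮ w in C(0, rs), doubleIntegrand α β γ φm rl a (k * ℓ * N : ℕ) a' c w) = 0 := by
    rw [circleIntegral.integral_congr (g := fun _ => 0) H.rs_pos.le hdouble]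
    simp [circleIntegral]
  rw [extKtil, hsingle, hdouble']
  simp

lemma minus_inv_mul_eq {z : ℂ} (hz : rs ≤ ‖z‖) (hz' : ‖z‖ ≤ rl) {a : ℕ} (ha : a ≤ k * ℓ * N) :
    (φm z)⁻¹ * prodPhiRange k ℓ α β γ z 0 (2 * a) =
      φp z * invProd k ℓ α β γ z (2 * a) (2 * (k * ℓ * N - a)) := by
  have h1 := invProd_mul H.α_pos H.β_pos H.γ_pos H.lt_rs H.rl_lt H.rs_pos hz hz' (2 * a)
    (2 * (k * ℓ * N - a))
  have h2 := prodPhiRange_mul (k := k) (ℓ := ℓ) (α := α) (β := β) (γ := γ) z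
    (Nat.zero_le (2 * a)) (show 2 * a ≤ 2 * a + 2 * (k * ℓ * N - a) by omega)
  have h3 := prodPhiRange_mul_period (k := k) (ℓ := ℓ) (α := α) (β := β) (γ := γ) z (k * N) 0
  rw [prodPhiRange_self, mul_one, show 2 * ℓ * (k * N) + 0 = 2 * a + 2 * (k * ℓ * N - a) by
    rw [show 2 * ℓ * (k * N) = 2 * (k * ℓ * N) by ring]; omega] at h3
  rw [H.plus_eq hz hz', h3, ← h2, Matrix.mul_assoc, Matrix.mul_assoc, mul_eq_one_comm.1 h1,
    Matrix.mul_one]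

lemma cauchyTransform_colKernel_bottom {a : ℕ} (ha : a ≤ k * ℓ * N) {w : ℂ} (hw : rs ≤ ‖w‖)
    (hw' : ‖w‖ < rl) (p : Fin k) :
    cauchyTransform rl (colKernel α β γ φm a (-1) p) w = 2 * Real.pi * Complex.I *
      ((φm w)⁻¹ * prodPhiRange k ℓ α β γ w 0 (2 * a)) p (residue k (-1)) := by
  have hk : (0 : ℤ) < k := by exact_mod_cast Nat.pos_of_neZero k
  rw [H.minus_inv_mul_eq hw hw'.le ha]
  have hM := matOrd_invProd (k := k) (β := β) H.α_pos H.γ_pos H.rl_lt a (2 * (k * ℓ * N - a))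
  have hord : HasOrd rl 0 (fun z => (φp z * invProd k ℓ α β γ z (2 * a) (2 * (k * ℓ * N - a)))
      p (residue k (-1))) := by
    simp only [Matrix.mul_apply]
    refine HasOrd.sum _ fun r _ => ?_
    have h1 : HasOrd rl 0 (fun z => φp z p r) := ⟨_, H.diff_plus p r, fun z _ _ => by simp⟩
    refine (h1.mul (hM r _)).mono ?_
    rw [zero_add]
    refine le_entryOrd ?_
    have := (residue k (-1)).2
    omega
  rw [← hord.circleIntegral_sub_inv (H.ne_zero hw) hw']
  refine circleIntegral.integral_congr H.rl_pos.le fun z hz => ?_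
  have hz' : ‖z‖ = rl := by simpa using hz
  have hz0 := H.ne_zero (hz'.symm ▸ H.rs_lt_rl.le : rs ≤ ‖z‖)
  have hdiv : (-1 : ℤ) / (k : ℤ) = -1 := neg_one_ediv hk
  simp only [colKernel, colAt, hdiv, neg_neg, zpow_one,
    H.minus_inv_mul_eq (hz'.symm ▸ H.rs_lt_rl.le : rs ≤ ‖z‖) hz'.le ha, mul_inv]
  field_simp

lemma doubleIntegrand_bottom {a : ℕ} (ha : a ≤ k * ℓ * N) {w : ℂ} (hw : rs ≤ ‖w‖)
    (hw' : ‖w‖ < rl) (a' : ℕ) (c : ℤ) :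
    doubleIntegrand α β γ φm rl a (-1) a' c w = 2 * Real.pi * Complex.I *
      (((prodPhiRange k ℓ α β γ w 0 (2 * a' + 1))⁻¹ * prodPhiRange k ℓ α β γ w 0 (2 * a))
        (residue k c) (residue k (-1)) * w ^ (c / (k : ℤ))) := by
  have h1 : (prodPhiRange k ℓ α β γ w 0 (2 * a' + 1))⁻¹ * prodPhiRange k ℓ α β γ w 0 (2 * a) =
      ((prodPhiRange k ℓ α β γ w 0 (2 * a' + 1))⁻¹ * φm w) *
        ((φm w)⁻¹ * prodPhiRange k ℓ α β γ w 0 (2 * a)) := by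
    rw [Matrix.mul_assoc, Matrix.mul_nonsing_inv_cancel_left _ _ (H.isUnit_det_minus hw hw'.le)]
  rw [h1, Matrix.mul_apply, Finset.sum_mul, Finset.mul_sum]
  refine Finset.sum_congr rfl fun p _ => ?_
  rw [H.cauchyTransform_colKernel_bottom ha hw hw', rowKernel]
  ring

/-- The extended inverse Kasteleyn matrix vanishes just below the Aztec diamond. -/
lemma extKtil_bottom {a : ℕ} (ha : a ≤ k * ℓ * N) (a' : ℕ) (c : ℤ) (hc : -1 ≤ c) :
    extKtil α β γ φm rs rl a (-1) a' c = 0 := by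
  have hk : (0 : ℤ) < k := by exact_mod_cast Nat.pos_of_neZero k
  have hdiv : (-1 : ℤ) / (k : ℤ) = -1 := neg_one_ediv hk
  have hsph : ∀ w ∈ Metric.sphere (0 : ℂ) rs, ‖w‖ = rs := fun w hw => by simpa using hw
  have hdouble := circleIntegral.integral_congr H.rs_pos.le fun w hw =>
    H.doubleIntegrand_bottom ha (hsph w hw).ge ((hsph w hw).trans_lt H.rs_lt_rl) a' c
  rw [circleIntegral.integral_const_mul] at hdouble
  have hsuff : (∮ w in C(0, rs), ((prodPhiRange k ℓ α β γ w 0 (2 * a' + 1))⁻¹ *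
      prodPhiRange k ℓ α β γ w 0 (2 * a)) (residue k c) (residue k (-1)) * w ^ (c / (k : ℤ))) =
      ∮ ζ in C(0, 1), singleIntegrand α β γ a (-1) a' c ζ := by
    by_cases haa : a' < a
    · rw [circleIntegral_eq_of_differentiableAt H.rs_pos H.rs_lt_one.le fun z hz =>
        H.differentiableAt_singleIntegrand hz _ _ _ _]
      refine circleIntegral.integral_congr H.rs_pos.le fun w hw => ?_
      have hw0 := H.ne_zero (hsph w hw).ge
      simp only [singleIntegrand, if_pos haa, colAt, hdiv, neg_neg, zpow_one]
      rw [← prodPhiRange_mul w (Nat.zero_le (2 * a' + 1)) (show 2 * a' + 1 ≤ 2 * a by omega),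
        Matrix.nonsing_inv_mul_cancel_left _ _ (H.isUnit_det_prodPhiRange (hsph w hw).ge
          ((hsph w hw).trans_lt H.rs_lt_rl).le (Nat.zero_le _))]
      field_simp
    · have hzero : (∮ ζ in C(0, 1), singleIntegrand α β γ a (-1) a' c ζ) = 0 := by
        simp [singleIntegrand, if_neg haa, circleIntegral]
      rw [hzero]
      have hM := matOrd_invProd (k := k) (β := β) H.α_pos H.γ_pos H.rl_lt a (2 * (a' - a) + 1)
      have hord : HasOrd rl 0 (fun w => invProd k ℓ α β γ w (2 * a) (2 * (a' - a) + 1)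
          (residue k c) (residue k (-1)) * w ^ (c / (k : ℤ))) := by
        refine ((hM _ _).mul (hasOrd_zpow _)).mono ?_
        have h1 : -(c / (k : ℤ)) ≤ entryOrd k (((2 * (a' - a) + 1 : ℕ) : ℤ) % 2) (residue k c)
            (residue k (-1)) := by
          refine le_entryOrd ?_
          have h2 := residue_val (k := k) c
          have h3 := (residue k (-1)).2
          have h4 := Int.mul_ediv_add_emod c k
          have h5 : ((2 * (a' - a) + 1 : ℕ) : ℤ) % 2 = 1 := by omega
          rw [h5, h2]
          have h6 : ((residue k (-1) : ℕ) : ℤ) + 1 ≤ k := by exact_mod_cast h3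
          linarith
        linarith
      refine Eq.trans ?_ (hord.circleIntegral_eq_zero H.rs_pos H.rs_lt_rl.le)
      refine circleIntegral.integral_congr H.rs_pos.le fun w hw => ?_
      have hw1 := (hsph w hw).ge
      have hw2 := ((hsph w hw).trans_lt H.rs_lt_rl).le
      have hidx : 2 * a' + 1 = 2 * a + (2 * (a' - a) + 1) := by omega
      rw [← H.inv_prodPhiRange hw1 hw2, ← hidx,
        ← prodPhiRange_mul w (Nat.zero_le (2 * a)) (show 2 * a ≤ 2 * a' + 1 by omega),
        Matrix.mul_inv_rev, Matrix.mul_assoc, Matrix.nonsing_inv_mul _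
          (H.isUnit_det_prodPhiRange hw1 hw2 (Nat.zero_le _)), Matrix.mul_one]
  rw [extKtil, hdouble, hsuff]
  have hpi := Complex.two_pi_I_ne_zero
  field_simp
  ring

end WienerHopf
end Boundary

section Kasteleyn

variable {k ℓ N : ℕ} [NeZero k] [NeZero ℓ] {α β γ : Fin k → Fin ℓ → ℝ}
  {φp φm : ℂ → Matrix (Fin k) (Fin k) ℂ} {rs rl : ℝ}

omit [NeZero ℓ] in
lemma residue_eq_mk (m : ℕ) :
    (⟨(m + k - 1) % k, Nat.mod_lt _ (Nat.pos_of_neZero k)⟩ : Fin k) = residue k ((m : ℤ) - 1) := by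
  have hk := Nat.pos_of_neZero k
  refine Fin.ext (Int.natCast_inj.1 ?_)
  rw [residue_val]
  push_cast [show 1 ≤ m + k by omega]
  rw [show (m : ℤ) + k - 1 = (m : ℤ) - 1 + k by ring, Int.add_emod_right]

lemma residue_natCast (b : ℕ) :
    (⟨b % k, Nat.mod_lt _ (Nat.pos_of_neZero k)⟩ : Fin k) = residue k (b : ℤ) := by
  refine Fin.ext (Int.natCast_inj.1 ?_)
  rw [residue_val]
  push_cast
  rfl

omit [NeZero k] in
lemma prodPhiRange_inv_split (z : ℂ) (a' : ℕ) :
    (prodPhiRange k ℓ α β γ z 0 (2 * (a' % ℓ) + 1))⁻¹ *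
      (prodPhiRange k ℓ α β γ z 0 (2 * ℓ)) ^ (-((a' / ℓ : ℕ) : ℤ)) =
      (prodPhiRange k ℓ α β γ z 0 (2 * a' + 1))⁻¹ := by
  rw [Matrix.zpow_neg_natCast, ← Matrix.mul_inv_rev, prodPhiRange_mul_period]
  congr 2
  conv_rhs => rw [← Nat.div_add_mod a' ℓ]
  ring

lemma sum_ite_height_eq (M m : ℕ) (hm : m ≤ M) (f : ℤ → ℂ) (hf : f M = 0) (c : ℂ) :
    ∑ b : Fin M, (if (b : ℕ) = m then c * f (b : ℕ) else 0) = c * f m := by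
  rcases hm.eq_or_lt with rfl | h
  · rw [hf, mul_zero]
    exact Finset.sum_eq_zero fun b _ => if_neg b.2.ne
  · rw [Finset.sum_eq_single (⟨m, h⟩ : Fin M)]
    · simp
    · exact fun b _ hb => if_neg fun h' => hb (Fin.ext h')
    · simp

lemma sum_ite_height_succ_eq (M m : ℕ) (hm : m ≤ M) (f : ℤ → ℂ) (hf : f (-1) = 0) (c : ℂ) :
    ∑ b : Fin M, (if (b : ℕ) + 1 = m then c * f (b : ℕ) else 0) = c * f ((m : ℤ) - 1) := by
  rcases m with _ | m
  · simp [hf]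
  · rw [Finset.sum_eq_single (⟨m, hm⟩ : Fin M)]
    · simp
    · exact fun b _ hb => if_neg fun h' => hb (Fin.ext (by simpa using h'))
    · simp

/-- The action of the Kasteleyn matrix on a function that vanishes at the heights just outside
the Aztec diamond. -/
lemma sum_KAz_mul (wl : Fin (k * ℓ * N) × Fin (k * ℓ * N + 1)) (g : ℕ → ℤ → ℂ)
    (htop : ∀ a, g a (k * ℓ * N : ℕ) = 0) (hbot : ∀ a ≤ k * ℓ * N, g a (-1) = 0) :
    ∑ bl : Fin (k * ℓ * N + 1) × Fin (k * ℓ * N), KAz k ℓ N α β γ wl bl * g bl.1 (bl.2 : ℕ) =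
      (α (residue k ((wl.2 : ℕ) - 1)) (colIdx ℓ wl.1) : ℂ) * g wl.1 (wl.2 : ℕ) +
      (γ (residue k ((wl.2 : ℕ) - 1)) (colIdx ℓ wl.1) : ℂ) * g wl.1 ((wl.2 : ℕ) - 1) +
      (β (residue k ((wl.2 : ℕ) - 1)) (colIdx ℓ wl.1) : ℂ) * g (wl.1 + 1) (wl.2 : ℕ) +
      (-1) * g (wl.1 + 1) ((wl.2 : ℕ) - 1) := by
  obtain ⟨⟨a, ha⟩, ⟨m, hm⟩⟩ := wl
  have hm' : m ≤ k * ℓ * N := Nat.lt_succ_iff.1 hm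
  rw [Fintype.sum_prod_type,
    Fintype.sum_eq_add (⟨a, by omega⟩ : Fin (k * ℓ * N + 1)) ⟨a + 1, by omega⟩ (by simp)]
  · rw [← sum_ite_height_eq _ m hm' (g a) (htop _),
      ← sum_ite_height_succ_eq _ m hm' (g a) (hbot a ha.le),
      ← sum_ite_height_eq _ m hm' (g (a + 1)) (htop _),
      ← sum_ite_height_succ_eq _ m hm' (g (a + 1)) (hbot (a + 1) ha)]
    simp only [← Finset.sum_add_distrib]
    refine Finset.sum_congr rfl fun b _ => ?_
    simp only [KAz, residue_eq_mk, colIdx]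
    split_ifs <;> first | omega | simp_all
  · rintro ⟨x, hx⟩ ⟨h1, h2⟩
    refine Finset.sum_eq_zero fun b _ => mul_eq_zero_of_left ?_ _
    simp only [ne_eq, Fin.mk.injEq] at h1 h2
    simp [KAz, h1, h2]

namespace WienerHopf

variable (H : WienerHopf k ℓ N α β γ φp φm rs rl)

include H

lemma plus_mul_eq {z : ℂ} (hz : rs ≤ ‖z‖) (hz' : ‖z‖ ≤ rl) (a : ℕ) :
    φp z * (prodPhiRange k ℓ α β γ z 0 (2 * ℓ)) ^ (((a / ℓ : ℕ) : ℤ) - (k * N : ℕ)) *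
      prodPhiRange k ℓ α β γ z 0 (2 * (a % ℓ)) =
      (φm z)⁻¹ * prodPhiRange k ℓ α β γ z 0 (2 * a) := by
  have hu := H.isUnit_det_prodPhiRange hz hz' (Nat.zero_le (2 * ℓ))
  rw [H.plus_eq hz hz', Matrix.mul_assoc, Matrix.mul_assoc, ← Matrix.mul_assoc (_ ^ (k * N)),
    ← _root_.zpow_natCast _ (k * N), ← Matrix.zpow_add hu, add_sub_cancel, _root_.zpow_natCast,
    prodPhiRange_mul_period]
  congr 2
  conv_rhs => rw [← Nat.div_add_mod a ℓ]
  ring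

lemma Ktil_eq (bl : Fin (k * ℓ * N + 1) × Fin (k * ℓ * N))
    (wl : Fin (k * ℓ * N) × Fin (k * ℓ * N + 1)) :
    Ktil k ℓ N α β γ φp φm rs rl bl wl =
      extKtil α β γ φm rs rl bl.1 ((bl.2 : ℕ) : ℤ) wl.1 (((wl.2 : ℕ) : ℤ) - 1) := by
  obtain ⟨⟨a, ha⟩, ⟨b, hb⟩⟩ := bl
  obtain ⟨⟨a', ha'⟩, ⟨m', hm'⟩⟩ := wl
  simp only [Ktil, extKtil, residue_eq_mk]
  simp only [residue_natCast, Int.fdiv_eq_ediv_of_nonneg _ (Int.natCast_nonneg k)]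
  have hk : (0 : ℤ) < k := by exact_mod_cast Nat.pos_of_neZero k
  congr 1
  · by_cases h : a' < a
    · rw [if_pos h, neg_one_mul]
      congr 1
      refine circleIntegral.integral_congr zero_le_one fun ζ hζ => ?_
      have hζ0 : ζ ≠ 0 := ne_zero_of_norm_ne_zero (by
        have : ‖ζ‖ = 1 := by simpa using hζ
        simp [this])
      simp only [singleIntegrand, if_pos h, colAt]
      rw [zpow_sub₀ hζ0, _root_.zpow_neg, Int.natCast_ediv, div_eq_mul_inv]
      ring
    · simp [singleIntegrand, if_neg h, circleIntegral]
  · congr 1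
    refine circleIntegral.integral_congr H.rs_pos.le fun w hw => ?_
    have hw' : ‖w‖ = rs := by simpa using hw
    have hlt : ‖w‖ < rl := hw'.trans_lt H.rs_lt_rl
    simp only [doubleIntegrand, cauchyTransform]
    simp only [← circleIntegral.integral_const_mul]
    rw [← circleIntegral.integral_fun_sum]
    · refine circleIntegral.integral_congr H.rl_pos.le fun z hz => ?_
      have hz' : ‖z‖ = rl := by simpa using hz
      have hmat : (prodPhiRange k ℓ α β γ w 0 (2 * (a' % ℓ) + 1))⁻¹ *
              (prodPhiRange k ℓ α β γ w 0 (2 * ℓ)) ^ (-((a' / ℓ : ℕ) : ℤ)) *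
              φm w * φp z *
              (prodPhiRange k ℓ α β γ z 0 (2 * ℓ)) ^ (((a / ℓ : ℕ) : ℤ) - (k * N : ℕ)) *
              prodPhiRange k ℓ α β γ z 0 (2 * (a % ℓ)) =
          ((prodPhiRange k ℓ α β γ w 0 (2 * a' + 1))⁻¹ * φm w) *
            ((φm z)⁻¹ * prodPhiRange k ℓ α β γ z 0 (2 * a)) := by
        rw [prodPhiRange_inv_split, Matrix.mul_assoc (_ * φm w), Matrix.mul_assoc (_ * φm w),
          H.plus_mul_eq (hz'.symm ▸ H.rs_lt_rl.le) hz'.le]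
      have hpow : ((z : ℂ) ^ (b / k))⁻¹ = z ^ (-((b : ℤ) / (k : ℤ))) := by
        rw [_root_.zpow_neg, ← Int.natCast_ediv, _root_.zpow_natCast]
      simp only [hmat, hpow]
      rw [Matrix.mul_apply, Finset.sum_mul, Finset.sum_mul, Finset.sum_mul]
      refine Finset.sum_congr rfl fun p _ => ?_
      simp only [rowKernel, colKernel, colAt]
      ring
    · intro p _
      exact ContinuousOn.circleIntegrable H.rl_pos.le
        (continuousOn_const.mul (continuousOn_cauchyKernel (H.continuousOn_colKernel _ _ _) hlt))

lemma sum_KAz_mul_Ktil (wl wl' : Fin (k * ℓ * N) × Fin (k * ℓ * N + 1)) :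
    (∑ bl : Fin (k * ℓ * N + 1) × Fin (k * ℓ * N),
      KAz k ℓ N α β γ wl bl * Ktil k ℓ N α β γ φp φm rs rl bl wl') = if wl = wl' then 1 else 0 := by
  simp only [H.Ktil_eq]
  rw [sum_KAz_mul wl (fun a b => extKtil α β γ φm rs rl a b wl'.1 (((wl'.2 : ℕ) : ℤ) - 1))]
  · have h := H.extKtil_relation wl.1 (((wl.2 : ℕ) : ℤ) - 1) wl'.1 (((wl'.2 : ℕ) : ℤ) - 1)
    rw [sub_add_cancel] at h
    rw [h]
    refine if_congr ?_ rfl rfl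
    rw [Prod.ext_iff, Fin.ext_iff, Fin.ext_iff]
    omega
  · intro a
    refine H.extKtil_top _ _ _ ?_
    have := wl'.2.2
    zify at this
    linarith
  · exact fun a ha => H.extKtil_bottom ha _ _ (by omega)

end WienerHopf
end Kasteleyn

end AztecInverse

/-- Theorem 2.4 (inverse Kasteleyn matrix): under the Wiener–Hopf assumptions,
`K_{G_Az} · K̃` is the identity matrix. -/
theorem statement9 (k ℓ N : ℕ) [NeZero k] [NeZero ℓ] (hN : 1 ≤ N)
    (α β γ : Fin k → Fin ℓ → ℝ)
    (hα : ∀ j i, 0 < α j i) (hβ : ∀ j i, 0 < β j i) (hγ : ∀ j i, 0 < γ j i)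
    (hass : ∀ i : Fin ℓ, (∏ j, β j i) < 1 ∧ 1 < (∏ j, α j i) / (∏ j, γ j i))
    (rs rl : ℝ)
    (hrs : ∀ i : Fin ℓ, (∏ j, β j i) < rs) (hrs1 : rs < 1) (hrl1 : 1 < rl)
    (hrl : ∀ i : Fin ℓ, rl < (∏ j, α j i) / (∏ j, γ j i))
    (φp φm : ℂ → Matrix (Fin k) (Fin k) ℂ)
    (hφp : ∃ U : Set ℂ, IsOpen U ∧ Metric.closedBall 0 rl ⊆ U ∧
      (∀ p q : Fin k, AnalyticOnNhd ℂ (fun z => φp z p q) U) ∧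
      (∀ p q : Fin k, AnalyticOnNhd ℂ (fun z => (φp z)⁻¹ p q) U))
    (hφm : ∃ V : Set ℂ, IsOpen V ∧ {z : ℂ | rs ≤ ‖z‖} ⊆ V ∧
      (∀ p q : Fin k, AnalyticOnNhd ℂ (fun z => φm z p q) V) ∧
      (∀ p q : Fin k, AnalyticOnNhd ℂ (fun z => (φm z)⁻¹ p q) V))
    (hφmInf : ∀ p q : Fin k, Filter.Tendsto (fun z : ℂ => z ^ (ℓ * N) * φm z p q)
      (Bornology.cobounded ℂ) (nhds ((1 : Matrix (Fin k) (Fin k) ℂ) p q)))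
    (hfact : ∀ z : ℂ, rs ≤ ‖z‖ → ‖z‖ ≤ rl →
      (prodPhiRange k ℓ α β γ z 0 (2 * ℓ)) ^ (k * N) = φm z * φp z) :
    ∀ wl wl' : Fin (k * ℓ * N) × Fin (k * ℓ * N + 1),
      (∑ bl : Fin (k * ℓ * N + 1) × Fin (k * ℓ * N),
          KAz k ℓ N α β γ wl bl * Ktil k ℓ N α β γ φp φm rs rl bl wl') =
        if wl = wl' then 1 else 0 := by
  refine AztecInverse.WienerHopf.sum_KAz_mul_Ktil ?_
  obtain ⟨U, -, hU, hp, -⟩ := hφp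
  obtain ⟨V, -, hV, hm, hm'⟩ := hφm
  exact
    { α_pos := hα
      β_pos := hβ
      γ_pos := hγ
      rs_pos := (Finset.prod_pos fun j _ => hβ j 0).trans (hrs 0)
      lt_rs := hrs
      rs_lt_one := hrs1
      one_lt_rl := hrl1
      rl_lt := hrl
      diff_plus := fun p q z hz => (hp p q z (hU hz)).differentiableAt.differentiableWithinAt
      diff_minus := fun z hz p q => (hm p q z (hV hz)).differentiableAt
      diff_minus_inv := fun z hz p q => (hm' p q z (hV hz)).differentiableAt
      tendsto_minus := hφmInf
      factor := hfact }
end
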